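/- arXiv:2104.02148 — 4 statements merged into one kernel-verified Lean document; each statement's English description precedes it below -/
import Mathlib

section
/- Let F be a finite family of cylinders in ℝ³ (each the Minkowski sum of a compact convex set and a line through the origin) such that any two members intersect, and assume the lines of the cylinders have pairwise distinct directions. Then there is a line in ℝ³ intersecting at least |F|/28 members of F. -/
open scoped Pointwise

/-- determinant functional -/
def cylD (u w x : EuclideanSpace ℝ (Fin 3)) : ℝ :=
  x 0 * (u 1 * w 2 - u 2 * w 1) + x 1 * (u 2 * w 0 - u 0 * w 2) + x 2 * (u 0 * w 1 - u 1 * w 0)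

lemma cylD_swap (u w x : EuclideanSpace ℝ (Fin 3)) : cylD w u x = - cylD u w x := by
  simp only [cylD]; ring

lemma cylD_cont (u w : EuclideanSpace ℝ (Fin 3)) : Continuous (cylD u w) := by
  unfold cylD; fun_prop

lemma cylD_add_left (u w x : EuclideanSpace ℝ (Fin 3)) (t : ℝ) :
    cylD u w (x + t • u) = cylD u w x := by
  simp [cylD]; ring

lemma cylD_add_right (u w x : EuclideanSpace ℝ (Fin 3)) (t : ℝ) :
    cylD u w (x + t • w) = cylD u w x := by
  simp [cylD]; ring

lemma cylD_lin (u w x y : EuclideanSpace ℝ (Fin 3)) (a b : ℝ) :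
    cylD u w (a • x + b • y) = a * cylD u w x + b * cylD u w y := by
  simp [cylD]; ring

lemma cyl_span (u w x : EuclideanSpace ℝ (Fin 3)) (hw : w ≠ 0) (h : ¬ ∃ c : ℝ, u = c • w)
    (hx : cylD u w x = 0) : ∃ s t : ℝ, x = s • u + t • w := by
  simp only [cylD] at hx
  by_cases h0 : u 1 * w 2 - u 2 * w 1 = 0
  · by_cases h1 : u 2 * w 0 - u 0 * w 2 = 0
    · by_cases h2 : u 0 * w 1 - u 1 * w 0 = 0
      · exfalso
        apply h
        by_cases w0 : w 0 = 0
        · by_cases w1 : w 1 = 0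
          · by_cases w2 : w 2 = 0
            · exfalso; apply hw; ext i; fin_cases i <;> simpa
            · refine ⟨u 2 / w 2, ?_⟩
              ext i; fin_cases i <;> simp <;> field_simp <;> linarith
          · refine ⟨u 1 / w 1, ?_⟩
            ext i; fin_cases i <;> simp <;> field_simp <;> linarith
        · refine ⟨u 0 / w 0, ?_⟩
          ext i; fin_cases i <;> simp <;> field_simp <;> linarith
      · refine ⟨(x 0 * w 1 - x 1 * w 0) / (u 0 * w 1 - u 1 * w 0),
          (u 0 * x 1 - u 1 * x 0) / (u 0 * w 1 - u 1 * w 0), ?_⟩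
        ext i; fin_cases i <;> simp <;> rw [div_mul_eq_mul_div, div_mul_eq_mul_div, ← add_div, eq_div_iff h2]
        · ring
        · ring
        · linear_combination hx
    · refine ⟨(x 2 * w 0 - x 0 * w 2) / (u 2 * w 0 - u 0 * w 2),
          (u 2 * x 0 - u 0 * x 2) / (u 2 * w 0 - u 0 * w 2), ?_⟩
      ext i; fin_cases i <;> simp <;> rw [div_mul_eq_mul_div, div_mul_eq_mul_div, ← add_div, eq_div_iff h1]
      · ring
      · linear_combination hx
      · ring
  · refine ⟨(x 1 * w 2 - x 2 * w 1) / (u 1 * w 2 - u 2 * w 1),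
          (u 1 * x 2 - u 2 * x 1) / (u 1 * w 2 - u 2 * w 1), ?_⟩
    ext i; fin_cases i <;> simp <;> rw [div_mul_eq_mul_div, div_mul_eq_mul_div, ← add_div, eq_div_iff h0]
    · linear_combination hx
    · ring
    · ring

lemma cyl_coord (u : EuclideanSpace ℝ (Fin 3)) (hu : u ≠ 0) :
    ∃ (p q : EuclideanSpace ℝ (Fin 3)) (f g : EuclideanSpace ℝ (Fin 3) → ℝ),
      Continuous f ∧ Continuous g ∧ ∀ x, ∃ h : ℝ, x = (f x • p + g x • q) + h • u := by
  by_cases w0 : u 0 = 0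
  · by_cases w1 : u 1 = 0
    · by_cases w2 : u 2 = 0
      · exfalso; apply hu; ext i; fin_cases i <;> simpa
      · refine ⟨!₂[1,0,0], !₂[0,1,0], fun x => x 0 - x 2 / u 2 * u 0,
          fun x => x 1 - x 2 / u 2 * u 1, by fun_prop, by fun_prop, fun x => ⟨x 2 / u 2, ?_⟩⟩
        ext i; fin_cases i <;> simp [w2]
    · refine ⟨!₂[1,0,0], !₂[0,0,1], fun x => x 0 - x 1 / u 1 * u 0,
          fun x => x 2 - x 1 / u 1 * u 2, by fun_prop, by fun_prop, fun x => ⟨x 1 / u 1, ?_⟩⟩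
      ext i; fin_cases i <;> simp [w1]
  · refine ⟨!₂[0,1,0], !₂[0,0,1], fun x => x 1 - x 0 / u 0 * u 1,
          fun x => x 2 - x 0 / u 0 * u 2, by fun_prop, by fun_prop, fun x => ⟨x 0 / u 0, ?_⟩⟩
    ext i; fin_cases i <;> simp [w0]

lemma cyl_1d_aux (v D w lo hi k : ℝ) (hD : 0 ≤ D) (hDw : D ≤ 3 * w) (hw : w ≤ hi - lo)
    (h1 : lo ≤ k) (h2 : k ≤ hi) (h3 : v ≤ k) (h4 : k ≤ v + D) :
    ∃ i : Fin 4, lo ≤ v + (i : ℝ) / 3 * D ∧ v + (i : ℝ) / 3 * D ≤ hi := by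
  by_cases c0 : lo ≤ v
  · exact ⟨0, by simp; constructor <;> linarith⟩
  by_cases c1 : lo ≤ v + 1 / 3 * D
  · exact ⟨1, by simp; constructor <;> linarith⟩
  by_cases c2 : lo ≤ v + 2 / 3 * D
  · exact ⟨2, by simp; constructor <;> linarith⟩
  · exact ⟨3, by simp; constructor <;> linarith⟩

lemma cyl_1d (v D w lo hi k : ℝ) (hDw : |D| ≤ 3 * w) (hw : w ≤ hi - lo)
    (h1 : lo ≤ k) (h2 : k ≤ hi) (h3 : min v (v + D) ≤ k) (h4 : k ≤ max v (v + D)) :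
    ∃ i : Fin 4, lo ≤ v + (i : ℝ) / 3 * D ∧ v + (i : ℝ) / 3 * D ≤ hi := by
  rcases le_total 0 D with h | h
  · rw [abs_of_nonneg h] at hDw
    rw [min_eq_left (by linarith)] at h3
    rw [max_eq_right (by linarith)] at h4
    exact cyl_1d_aux v D w lo hi k h hDw hw h1 h2 h3 h4
  · rw [abs_of_nonpos h] at hDw
    rw [min_eq_right (by linarith)] at h3
    rw [max_eq_left (by linarith)] at h4
    obtain ⟨i, hi1, hi2⟩ := cyl_1d_aux (-v) (-D) w (-hi) (-lo) (-k) (by linarith) hDw (by linarith)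
      (by linarith) (by linarith) (by linarith) (by linarith)
    exact ⟨i, by linarith, by linarith⟩

/-- numeric core -/
lemma cyl_core (α β W H w x0 y0 kx ky dx lo hi : ℝ) (hW : 0 ≤ W) (hH : 0 ≤ H)
    (hx1 : x0 ≤ kx) (hx2 : kx ≤ x0 + W) (hy1 : y0 ≤ ky) (hy2 : ky ≤ y0 + H)
    (hdx : |dx| ≤ W) (hw1 : |α * W| ≤ w) (hw2 : |α * dx + β * H| ≤ w) (hw : w ≤ hi - lo)
    (h1 : lo ≤ α * kx + β * ky) (h2 : α * kx + β * ky ≤ hi) :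
    ∃ (b : Bool) (i : Fin 4),
      lo ≤ α * (x0 + (i : ℝ) / 3 * W) +
        β * (if b then y0 + (i : ℝ) / 3 * H else y0 + H - (i : ℝ) / 3 * H) ∧
      α * (x0 + (i : ℝ) / 3 * W) +
        β * (if b then y0 + (i : ℝ) / 3 * H else y0 + H - (i : ℝ) / 3 * H) ≤ hi := by
  have e1 : |α * dx| ≤ w := by
    rw [abs_mul] at hw1 ⊢
    rw [abs_of_nonneg hW] at hw1
    exact (mul_le_mul_of_nonneg_left hdx (abs_nonneg _)).trans hw1
  have e2 : |β * H| ≤ 2 * w := by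
    have := abs_sub (α * dx + β * H) (α * dx)
    have e : α * dx + β * H - α * dx = β * H := by ring
    rw [e] at this; linarith
  have key : |α * W| + |β * H| ≤ 3 * w := by linarith
  have p1 : |α * W + β * H| ≤ 3 * w := (abs_add_le _ _).trans key
  have p2 : |α * W - β * H| ≤ 3 * w := (abs_sub _ _).trans key
  have fin1 : ∀ (hmin : min (α * x0 + β * y0) (α * x0 + β * y0 + (α * W + β * H)) ≤ α * kx + β * ky)
      (hmax : α * kx + β * ky ≤ max (α * x0 + β * y0) (α * x0 + β * y0 + (α * W + β * H))),
      ∃ i : Fin 4, lo ≤ α * (x0 + (i : ℝ) / 3 * W) + β * (y0 + (i : ℝ) / 3 * H) ∧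
        α * (x0 + (i : ℝ) / 3 * W) + β * (y0 + (i : ℝ) / 3 * H) ≤ hi := by
    intro hmin hmax
    obtain ⟨i, a, b⟩ := cyl_1d _ _ w lo hi _ p1 hw h1 h2 hmin hmax
    exact ⟨i, by linarith, by linarith⟩
  have fin2 : ∀ (hmin : min (α * x0 + β * (y0+H)) (α * x0 + β * (y0+H) + (α * W - β * H)) ≤ α * kx + β * ky)
      (hmax : α * kx + β * ky ≤ max (α * x0 + β * (y0+H)) (α * x0 + β * (y0+H) + (α * W - β * H))),
      ∃ i : Fin 4, lo ≤ α * (x0 + (i : ℝ) / 3 * W) + β * (y0 + H - (i : ℝ) / 3 * H) ∧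
        α * (x0 + (i : ℝ) / 3 * W) + β * (y0 + H - (i : ℝ) / 3 * H) ≤ hi := by
    intro hmin hmax
    obtain ⟨i, a, b⟩ := cyl_1d _ _ w lo hi _ p2 hw h1 h2 hmin hmax
    exact ⟨i, by linarith, by linarith⟩
  rcases le_total 0 α with ha | ha <;> rcases le_total 0 β with hb | hb
  · have q1 := mul_le_mul_of_nonneg_left hx1 ha
    have q2 := mul_le_mul_of_nonneg_left hx2 ha
    have q3 := mul_le_mul_of_nonneg_left hy1 hb
    have q4 := mul_le_mul_of_nonneg_left hy2 hb
    obtain ⟨i, h⟩ := fin1 (min_le_iff.2 (Or.inl (by linarith))) (le_max_iff.2 (Or.inr (by linarith)))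
    exact ⟨true, i, by simpa using h⟩
  · have q1 := mul_le_mul_of_nonneg_left hx1 ha
    have q2 := mul_le_mul_of_nonneg_left hx2 ha
    have q3 := mul_le_mul_of_nonpos_left hy1 hb
    have q4 := mul_le_mul_of_nonpos_left hy2 hb
    obtain ⟨i, h⟩ := fin2 (min_le_iff.2 (Or.inl (by linarith))) (le_max_iff.2 (Or.inr (by linarith)))
    exact ⟨false, i, by simpa using h⟩
  · have q1 := mul_le_mul_of_nonpos_left hx1 ha
    have q2 := mul_le_mul_of_nonpos_left hx2 ha
    have q3 := mul_le_mul_of_nonneg_left hy1 hb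
    have q4 := mul_le_mul_of_nonneg_left hy2 hb
    obtain ⟨i, h⟩ := fin2 (min_le_iff.2 (Or.inr (by linarith))) (le_max_iff.2 (Or.inl (by linarith)))
    exact ⟨false, i, by simpa using h⟩
  · have q1 := mul_le_mul_of_nonpos_left hx1 ha
    have q2 := mul_le_mul_of_nonpos_left hx2 ha
    have q3 := mul_le_mul_of_nonpos_left hy1 hb
    have q4 := mul_le_mul_of_nonpos_left hy2 hb
    obtain ⟨i, h⟩ := fin1 (min_le_iff.2 (Or.inr (by linarith))) (le_max_iff.2 (Or.inl (by linarith)))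
    exact ⟨true, i, by simpa using h⟩

/-- planar piercing lemma, for two coordinate functions on a compact set -/
lemma cyl_plane {E : Type*} [TopologicalSpace E] (K : Set E) (hne : K.Nonempty) (hc : IsCompact K)
    (f g : E → ℝ) (hf : Continuous f) (hg : Continuous g) :
    ∃ X : Bool × Fin 4 → ℝ × ℝ, ∀ α β lo hi : ℝ,
      (∃ k ∈ K, lo ≤ α * f k + β * g k ∧ α * f k + β * g k ≤ hi) →
      (∀ k ∈ K, ∀ k' ∈ K, (α * f k + β * g k) - (α * f k' + β * g k') ≤ hi - lo) →
      ∃ i, lo ≤ α * (X i).1 + β * (X i).2 ∧ α * (X i).1 + β * (X i).2 ≤ hi := by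
  obtain ⟨a, haK, ha⟩ := hc.exists_isMinOn hne hf.continuousOn
  obtain ⟨b, hbK, hb⟩ := hc.exists_isMaxOn hne hf.continuousOn
  have ha' : ∀ k ∈ K, f a ≤ f k := fun k hk => ha hk
  have hb' : ∀ k ∈ K, f k ≤ f b := fun k hk => hb hk
  obtain ⟨σ, hσ⟩ : ∃ σ : ℝ, f b - f a = 0 ∨ g b - σ * f b = g a - σ * f a := by
    by_cases h : f b - f a = 0
    · exact ⟨0, Or.inl h⟩
    · refine ⟨(g b - g a) / (f b - f a), Or.inr ?_⟩
      field_simp; ring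
  have hψ : Continuous (fun x => g x - σ * f x) := by fun_prop
  obtain ⟨d, hdK, hd⟩ := hc.exists_isMinOn hne hψ.continuousOn
  obtain ⟨c, hcK, hc'⟩ := hc.exists_isMaxOn hne hψ.continuousOn
  have hd2 : ∀ k ∈ K, g d - σ * f d ≤ g k - σ * f k := fun k hk => hd hk
  have hc2 : ∀ k ∈ K, g k - σ * f k ≤ g c - σ * f c := fun k hk => hc' hk
  set W := f b - f a with hW
  set y0 := g d - σ * f d with hy0
  set H := (g c - σ * f c) - y0 with hH
  refine ⟨fun bi => (f a + (bi.2 : ℝ) / 3 * W,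
    (if bi.1 then y0 + (bi.2 : ℝ) / 3 * H else y0 + H - (bi.2 : ℝ) / 3 * H)
      + σ * (f a + (bi.2 : ℝ) / 3 * W)), ?_⟩
  rintro α β lo hi ⟨k, hk, h1, h2⟩ hw
  have w1 := hw b hbK a haK
  have w2 := hw a haK b hbK
  have w3 := hw c hcK d hdK
  have w4 := hw d hdK c hcK
  have w5 := hw k hk k hk
  obtain ⟨bb, i, r1, r2⟩ := cyl_core (α + β * σ) β W H (hi - lo) (f a) y0 (f k) (g k - σ * f k)
    (f c - f d) lo hi (by linarith [ha' b hbK]) (by linarith [hd2 c hcK])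
    (ha' k hk) (by linarith [hb' k hk]) (hd2 k hk) (by linarith [hc2 k hk])
    (by rw [abs_le]; constructor <;> linarith [ha' c hcK, hb' c hcK, ha' d hdK, hb' d hdK])
    (by
      rcases hσ with h | h
      · rw [h]; simp; linarith
      · have e : (α + β * σ) * W = (α * f b + β * g b) - (α * f a + β * g a) := by
          rw [hW]; linear_combination (-β) * h
        rw [e, abs_le]; constructor <;> linarith)
    (by
      have e : (α + β * σ) * (f c - f d) + β * H
          = (α * f c + β * g c) - (α * f d + β * g d) := by
        rw [hH, hy0]; ring
      rw [e, abs_le]; constructor <;> linarith)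
    le_rfl (by linarith) (by linarith)
  refine ⟨(bb, i), ?_, ?_⟩
  · simp only; linarith
  · simp only; linarith

lemma cyl_pierce (u : EuclideanSpace ℝ (Fin 3)) (hu : u ≠ 0)
    (K : Set (EuclideanSpace ℝ (Fin 3))) (hne : K.Nonempty) (hc : IsCompact K) :
    ∃ X : Bool × Fin 4 → EuclideanSpace ℝ (Fin 3), ∀ (w : EuclideanSpace ℝ (Fin 3)) (lo hi : ℝ),
      (∃ k ∈ K, lo ≤ cylD u w k ∧ cylD u w k ≤ hi) →
      (∀ k ∈ K, ∀ k' ∈ K, cylD u w k - cylD u w k' ≤ hi - lo) →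
      ∃ i, lo ≤ cylD u w (X i) ∧ cylD u w (X i) ≤ hi := by
  obtain ⟨p, q, f, g, hf, hg, hx⟩ := cyl_coord u hu
  obtain ⟨X, hX⟩ := cyl_plane K hne hc f g hf hg
  have e : ∀ w x, cylD u w x = cylD u w p * f x + cylD u w q * g x := by
    intro w x
    obtain ⟨h, hh⟩ := hx x
    have := congrArg (cylD u w) hh
    rw [cylD_add_left, cylD_lin] at this
    linarith
  refine ⟨fun i => (X i).1 • p + (X i).2 • q, ?_⟩
  rintro w lo hi ⟨k, hk, h1, h2⟩ hw
  obtain ⟨i, r1, r2⟩ := hX (cylD u w p) (cylD u w q) lo hi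
    ⟨k, hk, by rw [← e]; exact h1, by rw [← e]; exact h2⟩
    (fun k hk k' hk' => by rw [← e, ← e]; exact hw k hk k' hk')
  refine ⟨i, ?_, ?_⟩
  · simp only [cylD_lin]; linarith
  · simp only [cylD_lin]; linarith

/-- the tournament relation -/
def cylR (u w : EuclideanSpace ℝ (Fin 3)) (K L : Set (EuclideanSpace ℝ (Fin 3))) : Prop :=
  ∃ l ∈ L, ∃ l' ∈ L, (∀ y ∈ L, cylD u w l' ≤ cylD u w y ∧ cylD u w y ≤ cylD u w l) ∧
    ∀ k ∈ K, ∀ k' ∈ K, cylD u w k - cylD u w k' ≤ cylD u w l - cylD u w l'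

lemma cylR_total (u w : EuclideanSpace ℝ (Fin 3)) (K L : Set (EuclideanSpace ℝ (Fin 3)))
    (hK : K.Nonempty) (hKc : IsCompact K) (hL : L.Nonempty) (hLc : IsCompact L) :
    cylR u w K L ∨ cylR w u L K := by
  obtain ⟨a, haK, ha⟩ := hKc.exists_isMinOn hK (cylD_cont u w).continuousOn
  obtain ⟨b, hbK, hb⟩ := hKc.exists_isMaxOn hK (cylD_cont u w).continuousOn
  obtain ⟨c, hcL, hc⟩ := hLc.exists_isMinOn hL (cylD_cont u w).continuousOn
  obtain ⟨d, hdL, hd⟩ := hLc.exists_isMaxOn hL (cylD_cont u w).continuousOn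
  have ha' : ∀ k ∈ K, cylD u w a ≤ cylD u w k := fun k hk => ha hk
  have hb' : ∀ k ∈ K, cylD u w k ≤ cylD u w b := fun k hk => hb hk
  have hc' : ∀ k ∈ L, cylD u w c ≤ cylD u w k := fun k hk => hc hk
  have hd' : ∀ k ∈ L, cylD u w k ≤ cylD u w d := fun k hk => hd hk
  rcases le_total (cylD u w b - cylD u w a) (cylD u w d - cylD u w c) with h | h
  · left
    refine ⟨d, hdL, c, hcL, fun y hy => ⟨hc' y hy, hd' y hy⟩, fun k hk k' hk' => ?_⟩
    linarith [hb' k hk, ha' k' hk']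
  · right
    refine ⟨a, haK, b, hbK, fun y hy => ?_, fun k hk k' hk' => ?_⟩
    · simp only [cylD_swap u w]
      exact ⟨by linarith [hb' y hy], by linarith [ha' y hy]⟩
    · simp only [cylD_swap u w]
      linarith [hd' k' hk', hc' k hk]

open Classical in
lemma cyl_tournament {ι : Type*} (s : Finset ι) (hs : s.Nonempty) (R : ι → ι → Prop)
    (hR : ∀ i ∈ s, ∀ j ∈ s, R i j ∨ R j i) :
    ∃ a ∈ s, s.card ≤ 2 * (s.filter (fun j => R a j)).card := by
  by_contra hcon
  push Not at hcon
  have h1 : ∑ a ∈ s, 2 * (s.filter (fun j => R a j)).card < ∑ a ∈ s, s.card :=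
    Finset.sum_lt_sum_of_nonempty hs hcon
  have h2 : ∑ a ∈ s, (s.filter (fun j => R a j)).card = ∑ a ∈ s, (s.filter (fun j => R j a)).card := by
    simp only [Finset.card_filter]
    exact Finset.sum_comm
  have h3 : ∑ a ∈ s, s.card ≤
      ∑ a ∈ s, ((s.filter (fun j => R a j)).card + (s.filter (fun j => R j a)).card) := by
    apply Finset.sum_le_sum
    intro a ha
    refine le_trans (Finset.card_le_card ?_) (Finset.card_union_le _ _)
    intro j hj
    simp only [Finset.mem_union, Finset.mem_filter]
    rcases hR a ha j hj with h | h
    · exact Or.inl ⟨hj, h⟩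
    · exact Or.inr ⟨hj, h⟩
  rw [Finset.sum_add_distrib, ← h2] at h3
  rw [← Finset.mul_sum] at h1
  omega

theorem cylinders_distinct_directions_transversal {ι : Type*} (s : Finset ι)
    (K : ι → Set (EuclideanSpace ℝ (Fin 3)))
    (v : ι → EuclideanSpace ℝ (Fin 3))
    (hK : ∀ i ∈ s, (K i).Nonempty ∧ Convex ℝ (K i) ∧ IsCompact (K i))
    (hv : ∀ i ∈ s, v i ≠ 0)
    (A : ι → Set (EuclideanSpace ℝ (Fin 3)))
    (hA : ∀ i ∈ s, A i = K i + {x : EuclideanSpace ℝ (Fin 3) | ∃ t : ℝ, x = t • v i})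
    (hdir : ∀ i ∈ s, ∀ j ∈ s, i ≠ j → ¬ ∃ c : ℝ, v i = c • v j)
    (hpair : ∀ i ∈ s, ∀ j ∈ s, (A i ∩ A j).Nonempty) :
    ∃ ℓ : Set (EuclideanSpace ℝ (Fin 3)),
      (∃ p w : EuclideanSpace ℝ (Fin 3), w ≠ 0 ∧
        ℓ = {x : EuclideanSpace ℝ (Fin 3) | ∃ t : ℝ, x = p + t • w}) ∧
      ∃ S ⊆ s, (s.card : ℝ) / 28 ≤ S.card ∧ ∀ i ∈ S, (ℓ ∩ A i).Nonempty := by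
  classical
  rcases s.eq_empty_or_nonempty with rfl | hs
  · refine ⟨_, ⟨0, !₂[1,0,0], ?_, rfl⟩, ∅, by simp, by simp, by simp⟩
    intro h
    have := congrArg (fun x : EuclideanSpace ℝ (Fin 3) => x 0) h
    simp at this
  by_cases hsmall : s.card ≤ 28
  · obtain ⟨a, ha⟩ := hs
    obtain ⟨k, hk⟩ := (hK a ha).1
    refine ⟨_, ⟨k, v a, hv a ha, rfl⟩, {a}, by simpa using ha, ?_, ?_⟩
    · have : (s.card : ℝ) ≤ 28 := by exact_mod_cast hsmall
      simp; linarith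
    · intro i hi
      rw [Finset.mem_singleton] at hi; subst hi
      refine ⟨k, ⟨0, by simp⟩, ?_⟩
      rw [hA i ha]
      exact ⟨k, hk, 0, ⟨0, by simp⟩, by simp⟩
  obtain ⟨a, ha, hcard⟩ := cyl_tournament s hs (fun i j => cylR (v i) (v j) (K i) (K j))
    (fun i hi j hj => cylR_total _ _ _ _ (hK i hi).1 (hK i hi).2.2 (hK j hj).1 (hK j hj).2.2)
  obtain ⟨X, hX⟩ := cyl_pierce (v a) (hv a ha) (K a) (hK a ha).1 (hK a ha).2.2
  set T := (s.filter (fun j => cylR (v a) (v j) (K a) (K j))).erase a with hT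
  have hTcard : s.card ≤ 2 * (T.card + 1) := by
    have h : (s.filter (fun j => cylR (v a) (v j) (K a) (K j))).card ≤ T.card + 1 :=
      Nat.sub_le_iff_le_add.1 Finset.pred_card_le_card_erase
    have h2 : s.card ≤ 2 * (s.filter (fun j => cylR (v a) (v j) (K a) (K j))).card := by
      convert hcard
    omega
  have hhit : ∀ j ∈ T, ∃ i, ({x | ∃ t : ℝ, x = X i + t • v a} ∩ A j).Nonempty := by
    intro j hj
    rw [hT, Finset.mem_erase, Finset.mem_filter] at hj
    obtain ⟨hja, hjs, l, hl, l', hl', hy, hw⟩ := hj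
    obtain ⟨z, hz1, hz2⟩ := hpair a ha j hjs
    rw [hA a ha] at hz1
    rw [hA j hjs] at hz2
    obtain ⟨k, hk, _, ⟨t, rfl⟩, hkz⟩ := hz1
    obtain ⟨y, hyK, _, ⟨t', rfl⟩, hyz⟩ := hz2
    have heq : cylD (v a) (v j) k = cylD (v a) (v j) y := by
      rw [← cylD_add_left (v a) (v j) k t, ← cylD_add_right (v a) (v j) y t']
      exact congrArg _ (hkz.trans hyz.symm)
    obtain ⟨i, r1, r2⟩ := hX (v j) (cylD (v a) (v j) l') (cylD (v a) (v j) l)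
      ⟨k, hk, by rw [heq]; exact (hy y hyK).1, by rw [heq]; exact (hy y hyK).2⟩ hw
    refine ⟨i, ?_⟩
    obtain ⟨m, hm, hmX⟩ := (hK j hjs).2.1.isPreconnected.intermediate_value hl' hl
      (cylD_cont (v a) (v j)).continuousOn ⟨r1, r2⟩
    have hz : cylD (v a) (v j) (m - X i) = 0 := by
      have := cylD_lin (v a) (v j) m (X i) 1 (-1)
      simp only [one_smul, neg_smul, ← sub_eq_add_neg] at this
      rw [this, hmX]; ring
    obtain ⟨s1, t1, hst⟩ := cyl_span _ _ _ (hv j hjs) (hdir a ha j hjs (Ne.symm hja)) hz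
    refine ⟨X i + s1 • v a, ⟨s1, rfl⟩, ?_⟩
    rw [hA j hjs]
    refine ⟨m, hm, (-t1) • v j, ⟨-t1, rfl⟩, ?_⟩
    have : m = X i + (s1 • v a + t1 • v j) := by rw [← hst]; abel
    simp only
    rw [this, neg_smul]; abel
  have hsum : T.card ≤ ∑ i : Bool × Fin 4,
      (T.filter (fun j => ({x | ∃ t : ℝ, x = X i + t • v a} ∩ A j).Nonempty)).card := by
    refine le_trans (Finset.card_le_card ?_) Finset.card_biUnion_le
    intro j hj
    obtain ⟨i, hi⟩ := hhit j hj
    exact Finset.mem_biUnion.2 ⟨i, Finset.mem_univ _, Finset.mem_filter.2 ⟨hj, hi⟩⟩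
  obtain ⟨i, hi⟩ : ∃ i, T.card ≤ 8 *
      (T.filter (fun j => ({x | ∃ t : ℝ, x = X i + t • v a} ∩ A j).Nonempty)).card := by
    by_contra hcon
    push Not at hcon
    have := Finset.sum_lt_sum_of_nonempty (s := (Finset.univ : Finset (Bool × Fin 4)))
      Finset.univ_nonempty (fun i _ => hcon i)
    rw [← Finset.mul_sum] at this
    simp only [Finset.sum_const, Finset.card_univ, Fintype.card_prod, Fintype.card_bool,
      Fintype.card_fin, smul_eq_mul] at this
    omega
  refine ⟨_, ⟨X i, v a, hv a ha, rfl⟩,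
    T.filter (fun j => ({x | ∃ t : ℝ, x = X i + t • v a} ∩ A j).Nonempty), ?_, ?_,
    fun j hj => (Finset.mem_filter.1 hj).2⟩
  · exact (Finset.filter_subset _ _).trans
      ((Finset.erase_subset _ _).trans (Finset.filter_subset _ _))
  · rw [div_le_iff₀ (by norm_num)]
    norm_cast
    omega
end

section
/- Let F be a finite family of cylinders in ℝ³ such that any two members of F intersect. Then there is a line intersecting at least |F|/28 members of F. -/
open scoped Pointwise

abbrev PE := EuclideanSpace ℝ (Fin 3)
def PHit (p v : PE) (A : Set PE) : Prop := ∃ t : ℝ, p + t • v ∈ A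
def PGood (v : PE) (A B C : Set PE) : Prop := ∃ p, PHit p v A ∧ PHit p v B ∧ PHit p v C
def PInv (v : PE) (A : Set PE) : Prop := ∀ x ∈ A, ∀ t : ℝ, x + t • v ∈ A

/-- three vectors summing with the fourth to zero: sign argument -/
lemma generic_sign {A B C : Set PE} (hA : Convex ℝ A) (hB : Convex ℝ B) (hC : Convex ℝ C)
    (f g h : PE →ₗ[ℝ] ℝ)
    (hne : ∀ a ∈ A, ∀ b ∈ B, ∀ c ∈ C, f a + g b + h c ≠ 0)
    {a b c a' b' c' : PE} (ha : a ∈ A) (hb : b ∈ B) (hc : c ∈ C) (ha' : a' ∈ A) (hb' : b' ∈ B)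
    (hc' : c' ∈ C) (h1 : 0 < f a + g b + h c) : 0 < f a' + g b' + h c' := by
  by_contra hcon
  push Not at hcon
  set X := f a + g b + h c with hX
  set Y := f a' + g b' + h c' with hY
  have hpos : 0 < X - Y := by linarith
  set s := X / (X - Y) with hs
  have hs0 : 0 ≤ s := by positivity
  have hs1 : 0 ≤ 1 - s := by
    rw [hs, sub_nonneg, div_le_one hpos]; linarith
  apply hne _ (hA ha ha' hs1 hs0 (by ring)) _ (hB hb hb' hs1 hs0 (by ring)) _
    (hC hc hc' hs1 hs0 (by ring))
  simp only [map_add, map_smul, smul_eq_mul]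
  have : (1 - s) * X + s * Y = 0 := by
    have : s * (X - Y) = X := div_mul_cancel₀ _ hpos.ne'
    linarith
  rw [← this, hX, hY]; ring

lemma generic_case {A B C D : Set PE} (hA : Convex ℝ A) (hB : Convex ℝ B) (hC : Convex ℝ C)
    (hD : Convex ℝ D) (e : Module.Basis (Fin 3) ℝ PE)
    (iA : PInv (e 0) A) (iB : PInv (e 1) B) (iC : PInv (e 2) C) (iD : PInv (e 0 + e 1 + e 2) D)
    (hAB : (A ∩ B).Nonempty) (hAC : (A ∩ C).Nonempty) (hAD : (A ∩ D).Nonempty)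
    (hBC : (B ∩ C).Nonempty) (hBD : (B ∩ D).Nonempty) (hCD : (C ∩ D).Nonempty) :
    PGood (e 0) B C D ∨ PGood (e 1) A C D ∨ PGood (e 2) A B D := by
  have hrep : ∀ x : PE, x = e.coord 0 x • e 0 + e.coord 1 x • e 1 + e.coord 2 x • e 2 := by
    intro x
    have := e.sum_repr x
    rw [Fin.sum_univ_three] at this
    exact this.symm
  set c0 := e.coord 0
  set c1 := e.coord 1
  set c2 := e.coord 2
  by_contra hcon
  push Not at hcon
  obtain ⟨g0, g1, g2⟩ := hcon
  have n0 : ∀ x ∈ B, ∀ y ∈ C, ∀ z ∈ D, (-c2) x + c1 y + (c2 - c1) z ≠ 0 := by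
    intro x hx y hy z hz h
    simp only [LinearMap.neg_apply, LinearMap.sub_apply] at h
    apply g0
    refine ⟨c1 y • e 1 + c2 x • e 2, ⟨c0 x, ?_⟩, ⟨c0 y, ?_⟩, ⟨c0 z + (c1 y - c1 z), ?_⟩⟩
    · convert iB x hx (c1 y - c1 x) using 1
      linear_combination (norm := module) (-1:ℝ) • hrep x
    · convert iC y hy (c2 x - c2 y) using 1
      linear_combination (norm := module) (-1:ℝ) • hrep y
    · convert iD z hz (c1 y - c1 z) using 1
      have h2 : c2 x = c2 z + (c1 y - c1 z) := by linarith
      rw [h2]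
      linear_combination (norm := module) (-1:ℝ) • hrep z
  have n1 : ∀ x ∈ A, ∀ y ∈ C, ∀ z ∈ D, c2 x + (-c0) y + (c0 - c2) z ≠ 0 := by
    intro x hx y hy z hz h
    simp only [LinearMap.neg_apply, LinearMap.sub_apply] at h
    apply g1
    refine ⟨c0 y • e 0 + c2 x • e 2, ⟨c1 x, ?_⟩, ⟨c1 y, ?_⟩, ⟨c1 z + (c0 y - c0 z), ?_⟩⟩
    · convert iA x hx (c0 y - c0 x) using 1
      linear_combination (norm := module) (-1:ℝ) • hrep x
    · convert iC y hy (c2 x - c2 y) using 1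
      linear_combination (norm := module) (-1:ℝ) • hrep y
    · convert iD z hz (c0 y - c0 z) using 1
      have h2 : c2 x = c2 z + (c0 y - c0 z) := by linarith
      rw [h2]
      linear_combination (norm := module) (-1:ℝ) • hrep z
  have n2 : ∀ x ∈ A, ∀ y ∈ B, ∀ z ∈ D, (-c1) x + c0 y + (c1 - c0) z ≠ 0 := by
    intro x hx y hy z hz h
    simp only [LinearMap.neg_apply, LinearMap.sub_apply] at h
    apply g2
    refine ⟨c0 y • e 0 + c1 x • e 1, ⟨c2 x, ?_⟩, ⟨c2 y, ?_⟩, ⟨c2 z + (c0 y - c0 z), ?_⟩⟩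
    · convert iA x hx (c0 y - c0 x) using 1
      linear_combination (norm := module) (-1:ℝ) • hrep x
    · convert iB y hy (c1 x - c1 y) using 1
      linear_combination (norm := module) (-1:ℝ) • hrep y
    · convert iD z hz (c0 y - c0 z) using 1
      have h2 : c1 x = c1 z + (c0 y - c0 z) := by linarith
      rw [h2]
      linear_combination (norm := module) (-1:ℝ) • hrep z
  obtain ⟨ab, abA, abB⟩ := hAB
  obtain ⟨ac, acA, acC⟩ := hAC
  obtain ⟨ad, adA, adD⟩ := hAD
  obtain ⟨bc, bcB, bcC⟩ := hBC
  obtain ⟨bd, bdB, bdD⟩ := hBD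
  obtain ⟨cd, cdC, cdD⟩ := hCD
  have p0 := fun {a b c a' b' c'} => @generic_sign B C D hB hC hD _ _ _ n0 a b c a' b' c'
  have p1 := fun {a b c a' b' c'} => @generic_sign A C D hA hC hD _ _ _ n1 a b c a' b' c'
  have p2 := fun {a b c a' b' c'} => @generic_sign A B D hA hB hD _ _ _ n2 a b c a' b' c'
  simp only [LinearMap.neg_apply, LinearMap.sub_apply] at p0 p1 p2 n0 n1 n2
  -- points: col0 at (ab,cd,cd), (bd,ac,bd); col1 at (ab,cd,cd), (ad,bc,ad); col2 (ac,bd,bd),(ad,bc,ad)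
  have q0 := n0 _ abB _ cdC _ cdD
  rcases lt_or_gt_of_ne q0 with h | h
  · have h1 : 0 < c2 ab + -c0 cd + (c0 cd - c2 cd) := by linarith
    have h2 : ¬ 0 < -c2 bd + c1 ac + (c2 bd - c1 bd) := fun hh =>
      absurd (p0 bdB acC bdD abB cdC cdD hh) (by linarith)
    have h3 := n0 _ bdB _ acC _ bdD
    have h4 : 0 < -c1 ac + c0 bd + (c1 bd - c0 bd) := by
      have := lt_of_le_of_ne (not_lt.1 h2) h3
      linarith
    have h5 := p1 abA cdC cdD adA bcC adD h1
    have h6 := p2 acA bdB bdD adA bcB adD h4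
    linarith
  · have h1 : ¬ 0 < c2 ab + -c0 cd + (c0 cd - c2 cd) := by linarith
    have h2 := p0 abB cdC cdD bdB acC bdD h
    have h4 : ¬ 0 < -c1 ac + c0 bd + (c1 bd - c0 bd) := by linarith
    have h5 : ¬ 0 < c2 ad + -c0 bc + (c0 ad - c2 ad) := fun hh =>
      h1 (p1 adA bcC adD abA cdC cdD hh)
    have h6 : ¬ 0 < -c1 ad + c0 bc + (c1 ad - c0 ad) := fun hh =>
      h4 (p2 adA bcB adD acA bdB bdD hh)
    have h7 := n1 _ adA _ bcC _ adD
    have h8 := n2 _ adA _ bcB _ adD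
    have h9 := lt_of_le_of_ne (not_lt.1 h5) h7
    linarith

lemma convex_ivt {B : Set PE} (hB : Convex ℝ B) (f : PE →ₗ[ℝ] ℝ) {x y : PE} (hx : x ∈ B)
    (hy : y ∈ B) {r : ℝ} (h1 : f x ≤ r) (h2 : r ≤ f y) : ∃ z ∈ B, f z = r := by
  rcases eq_or_lt_of_le (h1.trans h2) with h | h
  · exact ⟨x, hx, by linarith⟩
  · have hpos : 0 < f y - f x := by linarith
    have hs0 : 0 ≤ (r - f x) / (f y - f x) := div_nonneg (by linarith) hpos.le
    have hs1 : 0 ≤ 1 - (r - f x) / (f y - f x) := by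
      rw [sub_nonneg, div_le_one hpos]; linarith
    refine ⟨_, hB hx hy hs1 hs0 (by ring), ?_⟩
    simp only [map_add, map_smul, smul_eq_mul]
    field_simp
    ring

lemma helly_one {B C D : Set PE} (hB : Convex ℝ B) (hC : Convex ℝ C)
    (hD : Convex ℝ D) (f : PE →ₗ[ℝ] ℝ)
    (hBC : (B ∩ C).Nonempty) (hBD : (B ∩ D).Nonempty) (hCD : (C ∩ D).Nonempty) :
    ∃ x ∈ B, ∃ y ∈ C, ∃ z ∈ D, f x = f z ∧ f y = f z := by
  obtain ⟨bc, bcB, bcC⟩ := hBC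
  obtain ⟨bd, bdB, bdD⟩ := hBD
  obtain ⟨cd, cdC, cdD⟩ := hCD
  have key1 : ∀ z ∈ B, f z = f cd → ∃ x ∈ B, ∃ y ∈ C, ∃ z ∈ D, f x = f z ∧ f y = f z :=
    fun z hz h => ⟨z, hz, cd, cdC, cd, cdD, h, rfl⟩
  have key2 : ∀ z ∈ C, f z = f bd → ∃ x ∈ B, ∃ y ∈ C, ∃ z ∈ D, f x = f z ∧ f y = f z :=
    fun z hz h => ⟨bd, bdB, z, hz, bd, bdD, rfl, h⟩
  have key3 : ∀ z ∈ D, f z = f bc → ∃ x ∈ B, ∃ y ∈ C, ∃ z ∈ D, f x = f z ∧ f y = f z :=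
    fun z hz h => ⟨bc, bcB, bc, bcC, z, hz, h.symm, h.symm⟩
  rcases le_total (f bc) (f bd) with h1 | h1 <;> rcases le_total (f bc) (f cd) with h2 | h2 <;>
    rcases le_total (f bd) (f cd) with h3 | h3
  · obtain ⟨z, hz, e⟩ := convex_ivt hC f bcC cdC h1 h3; exact key2 z hz e
  · obtain ⟨z, hz, e⟩ := convex_ivt hB f bcB bdB h2 h3; exact key1 z hz e
  · obtain ⟨z, hz, e⟩ := convex_ivt hD f cdD bdD h2 h1; exact key3 z hz e
  · obtain ⟨z, hz, e⟩ := convex_ivt hD f cdD bdD h2 h1; exact key3 z hz e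
  · obtain ⟨z, hz, e⟩ := convex_ivt hD f bdD cdD h1 h2; exact key3 z hz e
  · obtain ⟨z, hz, e⟩ := convex_ivt hD f bdD cdD h1 h2; exact key3 z hz e
  · obtain ⟨z, hz, e⟩ := convex_ivt hB f bdB bcB h3 h2; exact key1 z hz e
  · obtain ⟨z, hz, e⟩ := convex_ivt hC f cdC bcC h3 h1; exact key2 z hz e

lemma planar_case {B C D : Set PE} (hB : Convex ℝ B) (hC : Convex ℝ C)
    (hD : Convex ℝ D) (e : Module.Basis (Fin 3) ℝ PE) {vc vd : PE} {α β : ℝ} (hβ : β ≠ 0)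
    (hvc : vc = α • e 0 + β • e 1)
    (iB : PInv (e 1) B) (iC : PInv vc C) (iD : PInv vd D)
    (hBC : (B ∩ C).Nonempty) (hBD : (B ∩ D).Nonempty) (hCD : (C ∩ D).Nonempty) :
    PGood (e 0) B C D := by
  have hrep : ∀ x : PE, x = e.coord 0 x • e 0 + e.coord 1 x • e 1 + e.coord 2 x • e 2 := by
    intro x
    have := e.sum_repr x
    rw [Fin.sum_univ_three] at this
    exact this.symm
  set c0 := e.coord 0
  set c1 := e.coord 1
  set c2 := e.coord 2
  have main : ∃ x ∈ B, ∃ y ∈ C, ∃ z ∈ D, c2 x = c2 z ∧ c2 y = c2 z := by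
    by_cases h : c2 vd = 0
    · exact helly_one hB hC hD c2 hBC hBD hCD
    · obtain ⟨y, yB, yC⟩ := hBC
      obtain ⟨d, -, dD⟩ := hBD
      refine ⟨y, yB, y, yC, _, iD d dD ((c2 y - c2 d) / c2 vd), ?_, ?_⟩ <;>
      · simp only [map_add, map_smul, smul_eq_mul]
        field_simp
        ring
  obtain ⟨x, xB, y, yC, z, zD, h1, h2⟩ := main
  refine ⟨z, ⟨c0 x - c0 z, ?_⟩, ⟨c0 y - c0 z + (c1 z - c1 y) / β * α, ?_⟩, ⟨0, by simpa using zD⟩⟩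
  · convert iB x xB (c1 z - c1 x) using 1
    linear_combination (norm := module) (-1:ℝ) • hrep x + hrep z - h1 • e 2
  · convert iC y yC ((c1 z - c1 y) / β) using 1
    have h3 : (c1 z - c1 y) / β * β = c1 z - c1 y := div_mul_cancel₀ _ hβ
    rw [hvc]
    linear_combination (norm := module) (-1:ℝ) • hrep y + hrep z - h2 • e 2 - h3 • e 1

lemma PGood.swap12 {v A B C} (h : PGood v A B C) : PGood v B A C := by
  obtain ⟨p, a, b, c⟩ := h; exact ⟨p, b, a, c⟩

lemma exists_basis3 {x y z : PE} (h : LinearIndependent ℝ ![x, y, z]) :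
    ∃ e : Module.Basis (Fin 3) ℝ PE, e 0 = x ∧ e 1 = y ∧ e 2 = z := by
  refine ⟨basisOfLinearIndependentOfCardEqFinrank h (by simp), ?_, ?_, ?_⟩ <;> simp

lemma exists_basis2 {x y : PE} (h : LinearIndependent ℝ ![x, y]) :
    ∃ e : Module.Basis (Fin 3) ℝ PE, e 0 = x ∧ e 1 = y := by
  obtain ⟨z, hz⟩ : ∃ z, z ∉ Submodule.span ℝ (Set.range ![x, y]) := by
    by_contra hcon
    push Not at hcon
    have h1 : Submodule.span ℝ (Set.range ![x, y]) = ⊤ := by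
      rw [eq_top_iff]; intro z _; exact hcon z
    have h2 := finrank_span_eq_card h
    rw [h1, finrank_top] at h2
    simp at h2
  have h3 : LinearIndependent ℝ ![z, x, y] := by
    have := linearIndependent_finCons.2 ⟨h, hz⟩
    exact this
  obtain ⟨e, h0, h1, h2⟩ := exists_basis3 h3
  refine ⟨e.reindex (Equiv.swap 0 1 * Equiv.swap 0 2 : Equiv.Perm (Fin 3)), ?_, ?_⟩
  · rw [Module.Basis.reindex_apply, ← h1]; congr 1
  · rw [Module.Basis.reindex_apply, ← h2]; congr 1

lemma planar_case' {B C D : Set PE} (hB : Convex ℝ B) (hC : Convex ℝ C)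
    (hD : Convex ℝ D) {vs vb vc vd : PE} (hsb : LinearIndependent ℝ ![vs, vb])
    (hsc : LinearIndependent ℝ ![vs, vc]) (hn : ¬ LinearIndependent ℝ ![vs, vb, vc])
    (iB : PInv vb B) (iC : PInv vc C) (iD : PInv vd D)
    (hBC : (B ∩ C).Nonempty) (hBD : (B ∩ D).Nonempty) (hCD : (C ∩ D).Nonempty) :
    PGood vs B C D := by
  obtain ⟨e, h0, h1⟩ := exists_basis2 hsb
  have hmem : vc ∈ Submodule.span ℝ (Set.range ![vs, vb]) := by
    by_contra hcon
    apply hn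
    have := linearIndependent_finCons.2 ⟨hsb, hcon⟩
    have h3 : LinearIndependent ℝ ![vc, vs, vb] := this
    have := h3.comp ![1, 2, 0] (by decide)
    convert this using 1
    ext i; fin_cases i <;> rfl
  simp only [Matrix.range_cons, Matrix.range_empty, Set.union_empty, Set.singleton_union] at hmem
  obtain ⟨α, β, hab⟩ := Submodule.mem_span_pair.1 hmem
  have hβ : β ≠ 0 := by
    rintro rfl
    have := LinearIndependent.pair_iff.1 hsc α (-1) (by rw [← hab]; module)
    norm_num at this
  subst h0 h1
  exact planar_case hB hC hD e hβ hab.symm iB iC iD hBC hBD hCD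

lemma PHit.of_smul {p v : PE} {A : Set PE} {a : ℝ} (h : PHit p (a • v) A) : PHit p v A := by
  obtain ⟨t, ht⟩ := h
  exact ⟨t * a, by rwa [mul_smul]⟩

lemma PGood.of_smul {v : PE} {A B C : Set PE} {a : ℝ} (h : PGood (a • v) A B C) :
    PGood v A B C := by
  obtain ⟨p, h1, h2, h3⟩ := h
  exact ⟨p, h1.of_smul, h2.of_smul, h3.of_smul⟩

lemma PInv.smul {v : PE} {A : Set PE} (h : PInv v A) (a : ℝ) : PInv (a • v) A := by
  intro x hx t
  rw [← mul_smul]; exact h x hx _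

lemma li_sub {x y z : PE} (h : LinearIndependent ℝ ![x, y, z]) :
    LinearIndependent ℝ ![x, z] ∧ LinearIndependent ℝ ![y, z] := by
  constructor
  · have := h.comp ![0, 2] (by decide)
    convert this using 1
    ext i; fin_cases i <;> rfl
  · have := h.comp ![1, 2] (by decide)
    convert this using 1
    ext i; fin_cases i <;> rfl

lemma li_swap {x y : PE} (h : LinearIndependent ℝ ![x, y]) : LinearIndependent ℝ ![y, x] :=
  LinearIndependent.pair_symm_iff.1 h

lemma li_swap3 {x y z : PE} (h : LinearIndependent ℝ ![x, y, z]) :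
    LinearIndependent ℝ ![y, x, z] := by
  have := h.comp ![1, 0, 2] (by decide)
  convert this using 1
  ext i; fin_cases i <;> rfl

lemma quad {A B C D : Set PE} (hA : Convex ℝ A) (hB : Convex ℝ B) (hC : Convex ℝ C)
    (hD : Convex ℝ D) {va vb vc vd : PE} (hab : LinearIndependent ℝ ![va, vb])
    (hc0 : vc ≠ 0) (hd0 : vd ≠ 0)
    (iA : PInv va A) (iB : PInv vb B) (iC : PInv vc C) (iD : PInv vd D)
    (hAB : (A ∩ B).Nonempty) (hAC : (A ∩ C).Nonempty) (hAD : (A ∩ D).Nonempty)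
    (hBC : (B ∩ C).Nonempty) (hBD : (B ∩ D).Nonempty) (hCD : (C ∩ D).Nonempty) :
    PGood va B C D ∨ PGood vb A C D ∨ PGood vc A B D := by
  have hDC : (D ∩ C).Nonempty := by rwa [Set.inter_comm]
  have perm : ∀ {v A B C}, PGood v A B C → PGood v A C B := by
    rintro v A B C ⟨p, a, b, c⟩; exact ⟨p, a, c, b⟩
  by_contra hcon
  push Not at hcon
  obtain ⟨g0, g1, g2⟩ := hcon
  have ha0 : va ≠ 0 := hab.ne_zero 0
  have hb0 : vb ≠ 0 := hab.ne_zero 1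
  have hpar : ∀ w : PE, w ≠ 0 → LinearIndependent ℝ ![va, w] ∨ LinearIndependent ℝ ![vb, w] := by
    intro w hw
    by_contra h
    push Not at h
    rw [LinearIndependent.pair_iff' ha0, LinearIndependent.pair_iff' hb0] at h
    push Not at h
    obtain ⟨⟨s, hs⟩, ⟨t, ht⟩⟩ := h
    have := LinearIndependent.pair_iff.1 hab s (-t) (by rw [hs, neg_smul, ht]; simp)
    rw [this.1, zero_smul] at hs
    exact hw hs.symm
  have habc : LinearIndependent ℝ ![va, vb, vc] := by
    by_contra hn
    rcases hpar vc hc0 with h | h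
    · exact g0 (planar_case' hB hC hD hab h hn iB iC iD hBC hBD hCD)
    · exact g1 (planar_case' hA hC hD (li_swap hab) h (fun h => hn (li_swap3 h)) iA iC iD
        hAC hAD hCD)
  have habd : LinearIndependent ℝ ![va, vb, vd] := by
    by_contra hn
    rcases hpar vd hd0 with h | h
    · exact g0 (perm (planar_case' hB hD hC hab h hn iB iD iC hBD hBC hDC))
    · exact g1 (perm (planar_case' hA hD hC (li_swap hab) h (fun h => hn (li_swap3 h)) iA iD iC
        hAD hAC hDC))
  have hacd : LinearIndependent ℝ ![va, vc, vd] := by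
    by_contra hn
    have := planar_case' hC hD hB (li_sub habc).1 (li_sub habd).1 hn iC iD iB hCD
      (by rwa [Set.inter_comm]) (by rwa [Set.inter_comm])
    obtain ⟨p, h1, h2, h3⟩ := this
    exact g0 ⟨p, h3, h1, h2⟩
  have hbcd : LinearIndependent ℝ ![vb, vc, vd] := by
    by_contra hn
    have := planar_case' hC hD hA (li_sub habc).2 (li_sub habd).2 hn iC iD iA hCD
      (by rwa [Set.inter_comm]) (by rwa [Set.inter_comm])
    obtain ⟨p, h1, h2, h3⟩ := this
    exact g1 ⟨p, h3, h1, h2⟩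
  obtain ⟨e, h0, h1, h2⟩ := exists_basis3 habc
  have hrep := e.sum_repr vd
  rw [Fin.sum_univ_three, h0, h1, h2] at hrep
  set α := e.repr vd 0
  set β := e.repr vd 1
  set γ := e.repr vd 2
  have key : ∀ {x y z : PE} {s t : ℝ}, LinearIndependent ℝ ![x, y, z] → s • x + t • y ≠ z := by
    intro x y z s t h heq
    have := Fintype.linearIndependent_iff.1 h ![s, t, -1] (by
      simp [Fin.sum_univ_three, heq]) 2
    simp at this
  have hα : α ≠ 0 := fun h => key hbcd (by rw [h, zero_smul, zero_add] at hrep; exact hrep)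
  have hβ : β ≠ 0 := fun h => key hacd (by rw [h, zero_smul, add_zero] at hrep; exact hrep)
  have hγ : γ ≠ 0 := fun h => key habd (by rw [h, zero_smul, add_zero] at hrep; exact hrep)
  let e' := e.unitsSMul ![Units.mk0 α hα, Units.mk0 β hβ, Units.mk0 γ hγ]
  have e0 : e' 0 = α • va := by simp [e', Module.Basis.unitsSMul_apply, h0, Units.smul_def]
  have e1 : e' 1 = β • vb := by simp [e', Module.Basis.unitsSMul_apply, h1, Units.smul_def]
  have e2 : e' 2 = γ • vc := by simp [e', Module.Basis.unitsSMul_apply, h2, Units.smul_def]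
  have := generic_case hA hB hC hD e' (e0 ▸ iA.smul α) (e1 ▸ iB.smul β) (e2 ▸ iC.smul γ)
    (by rw [e0, e1, e2, hrep]; exact iD) hAB hAC hAD hBC hBD hCD
  rw [e0, e1, e2] at this
  rcases this with h | h | h
  · exact g0 h.of_smul
  · exact g1 h.of_smul
  · exact g2 h.of_smul

lemma exists_basis1 {x : PE} (hx : x ≠ 0) : ∃ e : Module.Basis (Fin 3) ℝ PE, e 0 = x := by
  obtain ⟨z, hz⟩ : ∃ z, z ∉ Submodule.span ℝ {x} := by
    by_contra hcon
    push Not at hcon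
    have h1 : Submodule.span ℝ {x} = ⊤ := by
      rw [eq_top_iff]; intro z _; exact hcon z
    have h2 := finrank_span_singleton (K := ℝ) hx
    rw [h1, finrank_top] at h2
    simp at h2
  obtain ⟨e, h0, -⟩ := exists_basis2 (x := x) (y := z) (by
    rw [LinearIndependent.pair_iff' hx]
    intro a h
    exact hz (Submodule.mem_span_singleton.2 ⟨a, h⟩))
  exact ⟨e, h0⟩

lemma parallel_class {ι : Type*} (s : Finset ι) (A : ι → Set PE) (hA : ∀ i ∈ s, Convex ℝ (A i))
    (hp : ∀ i ∈ s, ∀ j ∈ s, (A i ∩ A j).Nonempty) {v : PE} (hv : v ≠ 0)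
    (hi : ∀ i ∈ s, PInv v (A i)) : ∃ p w : PE, w ≠ 0 ∧ ∀ i ∈ s, PHit p w (A i) := by
  classical
  obtain ⟨e, h0⟩ := exists_basis1 hv
  have hrep : ∀ x : PE, x = e.coord 0 x • e 0 + e.coord 1 x • e 1 + e.coord 2 x • e 2 := by
    intro x
    have := e.sum_repr x
    rw [Fin.sum_univ_three] at this
    exact this.symm
  have hel := Convex.helly_theorem' (𝕜 := ℝ) (F := fun i => e.coord 2 '' A i) (s := s)
    (fun i hi => (hA i hi).linear_image _) (by
      intro I hI hc
      simp only [Module.finrank_self] at hc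
      rcases I.eq_empty_or_nonempty with rfl | ⟨i, hiI⟩
      · simp
      · have : ∃ j ∈ s, I ⊆ {i, j} := by
          by_cases h : ∃ j ∈ I, j ≠ i
          · obtain ⟨j, hj, hne⟩ := h
            refine ⟨j, hI hj, ?_⟩
            rw [Finset.eq_of_subset_of_card_le (s := {i, j}) (t := I)]
            · intro k hk; simp at hk; rcases hk with rfl | rfl <;> assumption
            · rw [Finset.card_pair hne.symm]; exact hc
          · push Not at h
            exact ⟨i, hI hiI, fun k hk => by simp [h k hk]⟩
        obtain ⟨j, hj, hIj⟩ := this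
        obtain ⟨x, x1, x2⟩ := hp i (hI hiI) j hj
        refine ⟨e.coord 2 x, ?_⟩
        simp only [Set.mem_iInter]
        intro k hk
        have := hIj hk
        simp only [Finset.mem_insert, Finset.mem_singleton] at this
        rcases this with rfl | rfl
        · exact ⟨x, x1, rfl⟩
        · exact ⟨x, x2, rfl⟩)
  obtain ⟨t, ht⟩ := hel
  simp only [Set.mem_iInter] at ht
  refine ⟨t • e 2, e 1, e.ne_zero 1, fun i his => ?_⟩
  obtain ⟨x, hx, rfl⟩ := ht i his
  refine ⟨e.coord 1 x, ?_⟩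
  convert hi i his x hx (- e.coord 0 x) using 1
  rw [← h0]
  linear_combination (norm := module) (-1:ℝ) • hrep x


lemma min_norm_unique {V : Type*} [NormedAddCommGroup V] [InnerProductSpace ℝ V] {K : Set V}
    (hK : Convex ℝ K) {x y : V} (hx : x ∈ K) (hy : y ∈ K) {r : ℝ} (hr : ∀ z ∈ K, r ≤ ‖z‖)
    (h1 : ‖x‖ ≤ r) (h2 : ‖y‖ ≤ r) : x = y := by
  have hm : (1/2:ℝ) • x + (1/2:ℝ) • y ∈ K := hK hx hy (by norm_num) (by norm_num) (by norm_num)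
  have h3 := hr _ hm
  rw [← smul_add, norm_smul] at h3
  have h4 := parallelogram_law_with_norm ℝ x y
  have h5 : ‖x - y‖ = 0 := by
    norm_num at h3
    nlinarith [norm_nonneg x, norm_nonneg y, norm_nonneg (x+y), norm_nonneg (x-y)]
  exact sub_eq_zero.1 (norm_eq_zero.1 h5)

lemma helly_four {V : Type*} [NormedAddCommGroup V] [InnerProductSpace ℝ V]
    [FiniteDimensional ℝ V] (hV : Module.finrank ℝ V = 2) {A B C D : Set V}
    (hA : Convex ℝ A) (hB : Convex ℝ B) (hC : Convex ℝ C) (hD : Convex ℝ D)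
    (h0 : (B ∩ C ∩ D).Nonempty) (h1 : (A ∩ C ∩ D).Nonempty) (h2 : (A ∩ B ∩ D).Nonempty)
    (h3 : (A ∩ B ∩ C).Nonempty) : (A ∩ B ∩ C ∩ D).Nonempty := by
  have := Convex.helly_theorem (𝕜 := ℝ) (F := ![A, B, C, D]) (s := Finset.univ)
    (by simp [hV]) (by intro i _; fin_cases i <;> assumption) (by
      intro I _ hI
      rw [hV] at hI
      have hc : Iᶜ.card = 1 := by
        rw [Finset.card_compl, hI]; rfl
      obtain ⟨k, hk⟩ := Finset.card_eq_one.1 hc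
      have hI2 : I = {k}ᶜ := by rw [← hk, compl_compl]
      subst hI2
      fin_cases k
      · obtain ⟨x, ⟨a, b⟩, c⟩ := h0
        exact ⟨x, by simp [Fin.forall_fin_succ, a, b, c]⟩
      · obtain ⟨x, ⟨a, b⟩, c⟩ := h1
        exact ⟨x, by simp [Fin.forall_fin_succ, a, b, c]⟩
      · obtain ⟨x, ⟨a, b⟩, c⟩ := h2
        exact ⟨x, by simp [Fin.forall_fin_succ, a, b, c]⟩
      · obtain ⟨x, ⟨a, b⟩, c⟩ := h3
        exact ⟨x, by simp [Fin.forall_fin_succ, a, b, c]⟩)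
  obtain ⟨x, hx⟩ := this
  simp [Fin.forall_fin_succ] at hx
  exact ⟨x, by simp [hx]⟩

lemma fh2 {V : Type*} [NormedAddCommGroup V] [InnerProductSpace ℝ V]
    [FiniteDimensional ℝ V] (hV : Module.finrank ℝ V = 2) {ι : Type*} [Finite ι]
    (K : ι → Set V) (hK : ∀ i, Convex ℝ (K i)) :
    ∃ q : ι → ι → V, ∀ j k l, (K j ∩ K k ∩ K l).Nonempty →
      q j k ∈ K l ∨ q j l ∈ K k ∨ q k l ∈ K j := by
  classical
  have hc : ∀ t : ι × ι × ι, ∃ c : V, (K t.1 ∩ K t.2.1 ∩ K t.2.2).Nonempty →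
      c ∈ K t.1 ∩ K t.2.1 ∩ K t.2.2 := by
    intro t
    by_cases h : (K t.1 ∩ K t.2.1 ∩ K t.2.2).Nonempty
    · exact ⟨h.some, fun _ => h.some_mem⟩
    · exact ⟨0, fun h' => absurd h' h⟩
  choose c hc using hc
  let W : ι → Set V := fun j => c '' {t | (K t.1 ∩ K t.2.1 ∩ K t.2.2).Nonempty ∧
    (j = t.1 ∨ j = t.2.1 ∨ j = t.2.2)}
  let L : ι → Set V := fun j => convexHull ℝ (W j)
  have hLc : ∀ j, Convex ℝ (L j) := fun j => convex_convexHull ℝ _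
  have hLcomp : ∀ j, IsCompact (L j) := fun j => ((Set.toFinite _).image c).isCompact_convexHull ℝ
  have hLK : ∀ j, L j ⊆ K j := by
    intro j
    apply convexHull_min _ (hK j)
    rintro _ ⟨t, ⟨h1, h2⟩, rfl⟩
    have := hc t h1
    rcases h2 with rfl | rfl | rfl
    · exact this.1.1
    · exact this.1.2
    · exact this.2
  have hq : ∀ j k, ∃ q : V, (L j ∩ L k).Nonempty → q ∈ L j ∩ L k ∧ ∀ y ∈ L j ∩ L k, ‖q‖ ≤ ‖y‖ := by
    intro j k
    by_cases h : (L j ∩ L k).Nonempty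
    · obtain ⟨q, hq, hm⟩ := ((hLcomp j).inter (hLcomp k)).exists_isMinOn h continuous_norm.continuousOn
      exact ⟨q, fun _ => ⟨hq, fun y hy => hm hy⟩⟩
    · exact ⟨0, fun h' => absurd h' h⟩
  choose q hq using hq
  refine ⟨q, fun j k l hne => ?_⟩
  have hT : (L j ∩ L k ∩ L l).Nonempty :=
    ⟨c (j, k, l), ⟨subset_convexHull ℝ _ ⟨(j, k, l), ⟨hne, by simp⟩, rfl⟩,
      subset_convexHull ℝ _ ⟨(j, k, l), ⟨hne, by simp⟩, rfl⟩⟩,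
      subset_convexHull ℝ _ ⟨(j, k, l), ⟨hne, by simp⟩, rfl⟩⟩
  obtain ⟨x, ⟨⟨xj, xk⟩, xl⟩, hm⟩ := (((hLcomp j).inter (hLcomp k)).inter (hLcomp l)).exists_isMinOn hT
    continuous_norm.continuousOn
  have fin : ∀ a b, x ∈ L a → x ∈ L b → ¬ (Metric.ball (0:V) ‖x‖ ∩ L a ∩ L b).Nonempty →
      q a b = x := by
    intro a b ha hb hn
    obtain ⟨h1, h2⟩ := hq a b ⟨x, ha, hb⟩
    refine min_norm_unique ((hLc a).inter (hLc b)) h1 ⟨ha, hb⟩ (r := ‖x‖) ?_ (h2 x ⟨ha, hb⟩) le_rfl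
    intro z hz
    by_contra hlt
    exact hn ⟨z, ⟨by simpa using hlt, hz.1⟩, hz.2⟩
  by_cases h1 : (Metric.ball (0:V) ‖x‖ ∩ L j ∩ L k).Nonempty
  · by_cases h2 : (Metric.ball (0:V) ‖x‖ ∩ L j ∩ L l).Nonempty
    · by_cases h3 : (Metric.ball (0:V) ‖x‖ ∩ L k ∩ L l).Nonempty
      · exfalso
        obtain ⟨y, ⟨⟨y0, yj⟩, yk⟩, yl⟩ := helly_four hV (convex_ball 0 _) (hLc j) (hLc k) (hLc l) hT h3 h2 h1
        have : ‖x‖ ≤ ‖y‖ := hm ⟨⟨yj, yk⟩, yl⟩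
        simp at y0
        linarith
      · right; right; rw [fin k l xk xl h3]; exact hLK _ xj
    · right; left; rw [fin j l xj xl h2]; exact hLK _ xk
  · left; rw [fin j k xj xk h1]; exact hLK _ xl

lemma fh3 {v : PE} (hv : v ≠ 0) {ι : Type*} [Finite ι] (A : ι → Set PE)
    (hA : ∀ i, Convex ℝ (A i)) : ∃ q : ι → ι → PE, ∀ j k l, PGood v (A j) (A k) (A l) →
      PHit (q j k) v (A l) ∨ PHit (q j l) v (A k) ∨ PHit (q k l) v (A j) := by
  let V := (Submodule.span ℝ {v})ᗮ
  let π : PE →L[ℝ] V := V.orthogonalProjectionOnto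
  have hV : Module.finrank ℝ V = 2 := by
    have : Fact (Module.finrank ℝ PE = 2 + 1) := ⟨by simp⟩
    exact Submodule.finrank_orthogonal_span_singleton hv
  have hπ : ∀ x y : PE, π x = π y → ∃ t : ℝ, x + t • v = y := by
    intro x y h
    have h1 : π (y - x) = 0 := by rw [map_sub, h, sub_self]
    have h2 : y - x ∈ Vᗮ := Submodule.orthogonalProjectionOnto_eq_zero_iff.1 h1
    rw [Submodule.orthogonal_orthogonal] at h2
    obtain ⟨t, ht⟩ := Submodule.mem_span_singleton.1 h2
    exact ⟨t, by rw [ht]; abel⟩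
  have hπv : π v = 0 := by
    apply Submodule.orthogonalProjectionOnto_eq_zero_iff.2
    rw [Submodule.orthogonal_orthogonal]
    exact Submodule.mem_span_singleton_self v
  have hπV : ∀ x : V, π (x : PE) = x := fun x => V.orthogonalProjectionOnto_mem_subspace_eq_self x
  obtain ⟨q, hq⟩ := fh2 hV (fun i => π '' A i)
    (fun i => (hA i).linear_image (π : PE →ₗ[ℝ] V))
  refine ⟨fun j k => (q j k : PE), fun j k l hg => ?_⟩
  have back : ∀ a b c, q a b ∈ π '' A c → PHit (q a b : PE) v (A c) := by
    rintro a b c ⟨x, hx, hxe⟩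
    obtain ⟨t, ht⟩ := hπ (q a b : PE) x (by rw [hπV, hxe])
    exact ⟨t, by rwa [ht]⟩
  obtain ⟨p, ⟨t1, h1⟩, ⟨t2, h2⟩, ⟨t3, h3⟩⟩ := hg
  have := hq j k l ⟨π p, ⟨⟨_, h1, by simp [hπv]⟩, ⟨_, h2, by simp [hπv]⟩⟩, ⟨_, h3, by simp [hπv]⟩⟩
  rcases this with h | h | h
  · exact Or.inl (back _ _ _ h)
  · exact Or.inr (Or.inl (back _ _ _ h))
  · exact Or.inr (Or.inr (back _ _ _ h))

open Classical in
lemma count4 {ι : Type*} [Fintype ι] (R : ι → ι → ι → ι → Prop) (m : ℕ)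
    (h : ∀ i j k, (Finset.univ.filter (fun l => R i j k l)).card ≤ m) :
    (Finset.univ.filter (fun f : Fin 4 → ι => R (f 0) (f 1) (f 2) (f 3))).card
      ≤ (Fintype.card ι)^3 * m := by
  have := Finset.card_le_mul_card_image_of_maps_to (s := Finset.univ.filter (fun f : Fin 4 → ι => R (f 0) (f 1) (f 2) (f 3)))
    (t := (Finset.univ : Finset (ι × ι × ι))) (f := fun f => (f 0, f 1, f 2)) (by simp) m (by
      rintro ⟨i, j, k⟩ -
      refine le_trans ?_ (h i j k)
      apply Finset.card_le_card_of_injOn (fun f => f 3)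
      · intro f hf
        simp only [Finset.coe_filter, Finset.mem_filter, Finset.mem_univ, true_and, Set.mem_ofPred_eq, Prod.mk.injEq] at hf ⊢
        obtain ⟨h1, rfl, rfl, rfl⟩ := hf
        exact h1
      · intro f hf g hg hfg
        simp only [Finset.coe_filter, Finset.mem_filter, Finset.mem_univ, true_and, Set.mem_ofPred_eq, Prod.mk.injEq] at hf hg
        ext a
        fin_cases a
        · exact hf.2.1.trans hg.2.1.symm
        · exact hf.2.2.1.trans hg.2.2.1.symm
        · exact hf.2.2.2.trans hg.2.2.2.symm
        · exact hfg)
  simp only [Finset.card_univ, Fintype.card_prod] at this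
  calc _ ≤ _ := this
    _ = _ := by ring

open Classical in
lemma core {ι : Type*} [Fintype ι] (A : ι → Set PE) (v : ι → PE) (hA : ∀ i, Convex ℝ (A i))
    (hv : ∀ i, v i ≠ 0) (hi : ∀ i, PInv (v i) (A i)) (hp : ∀ i j, (A i ∩ A j).Nonempty)
    (m : ℕ) (hm : 28 * m < Fintype.card ι)
    (hl : ∀ p w : PE, w ≠ 0 → (Finset.univ.filter (fun i => PHit p w (A i))).card ≤ m) : False := by
  choose q hq using fun i => fh3 (hv i) A hA
  let H : ι → ι → ι → ι → Prop := fun i j k l => PHit (q i j k) (v i) (A l)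
  let P : ι → ι → ι → ι → Prop := fun i _ _ l => ¬ LinearIndependent ℝ ![v i, v l]
  have cH := count4 H m (fun i j k => hl _ _ (hv i))
  have cP := count4 P m (by
    intro i _ _
    obtain ⟨p, w, hw, h⟩ := parallel_class
      (Finset.univ.filter (fun l => ¬ LinearIndependent ℝ ![v i, v l])) A (fun j _ => hA j)
      (fun j _ k _ => hp j k) (hv i) (by
        intro j hj
        simp only [Finset.mem_filter, Finset.mem_univ, true_and] at hj
        rw [LinearIndependent.pair_iff' (hv i)] at hj
        push Not at hj
        obtain ⟨a, ha⟩ := hj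
        have ha0 : a ≠ 0 := by
          rintro rfl
          exact hv j (by rw [← ha, zero_smul])
        have := (hi j).smul a⁻¹
        rwa [← ha, smul_smul, inv_mul_cancel₀ ha0, one_smul] at this)
    refine le_trans (Finset.card_le_card ?_) (hl p w hw)
    intro l hl
    simp only [Finset.mem_filter, Finset.mem_univ, true_and]
    have hl2 : P i i i l := by
      simp only [Finset.mem_filter] at hl
      exact hl.2
    exact h l (by simp only [Finset.mem_filter, Finset.mem_univ, true_and]; exact hl2))
  set SH := Finset.univ.filter (fun f : Fin 4 → ι => H (f 0) (f 1) (f 2) (f 3)) with hSH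
  set SP := Finset.univ.filter (fun f : Fin 4 → ι => P (f 0) (f 1) (f 2) (f 3)) with hSP
  have cP' : SP.card ≤ (Fintype.card ι)^3 * m := by
    rw [hSP]; convert cP
  let Sσ : Equiv.Perm (Fin 4) → Finset (Fin 4 → ι) := fun σ =>
    Finset.univ.filter (fun f : Fin 4 → ι => H (f (σ 0)) (f (σ 1)) (f (σ 2)) (f (σ 3)))
  have cσ : ∀ σ, (Sσ σ).card ≤ (Fintype.card ι)^3 * m := by
    intro σ
    refine le_trans (Finset.card_le_card_of_injOn (fun f => f ∘ σ) ?_ ?_) cH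
    · intro f hf
      simpa [Sσ, hSH] using hf
    · intro f _ g _ hfg
      exact σ.surjective.injective_comp_right hfg
  have cov : (Finset.univ : Finset (Fin 4 → ι)) ⊆ SP ∪ Finset.univ.biUnion Sσ := by
    intro f _
    by_cases hf : P (f 0) (f 1) (f 2) (f 3)
    · exact Finset.mem_union_left _ (by simp [hSP, hf])
    apply Finset.mem_union_right
    have fromH : ∀ a b c d : Fin 4, Function.Injective ![a, b, c, d] →
        H (f a) (f b) (f c) (f d) → f ∈ Finset.univ.biUnion Sσ := by
      intro a b c d hinj h
      simp only [Finset.mem_biUnion, Finset.mem_univ, true_and]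
      refine ⟨Equiv.ofBijective _ (Finite.injective_iff_bijective.1 hinj), ?_⟩
      simpa [Sσ] using h
    have hLI : LinearIndependent ℝ ![v (f 0), v (f 3)] := not_not.1 hf
    have := quad (hA (f 0)) (hA (f 3)) (hA (f 1)) (hA (f 2)) hLI (hv _) (hv _) (hi _) (hi _)
      (hi _) (hi _) (hp _ _) (hp _ _) (hp _ _) (hp _ _) (hp _ _) (hp _ _)
    rcases this with h | h | h
    · rcases hq _ _ _ _ h with h | h | h
      · exact fromH 0 3 1 2 (by decide) h
      · exact fromH 0 3 2 1 (by decide) h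
      · exact fromH 0 1 2 3 (by decide) h
    · rcases hq _ _ _ _ h with h | h | h
      · exact fromH 3 0 1 2 (by decide) h
      · exact fromH 3 0 2 1 (by decide) h
      · exact fromH 3 1 2 0 (by decide) h
    · rcases hq _ _ _ _ h with h | h | h
      · exact fromH 1 0 3 2 (by decide) h
      · exact fromH 1 0 2 3 (by decide) h
      · exact fromH 1 3 2 0 (by decide) h
  have h1 := (Finset.card_le_card cov).trans (Finset.card_union_le _ _)
  have h2 : (Finset.univ.biUnion Sσ).card ≤ 24 * ((Fintype.card ι)^3 * m) := by
    have := Finset.card_biUnion_le_card_mul Finset.univ Sσ _ (fun σ _ => cσ σ)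
    have h24 : (Finset.univ : Finset (Equiv.Perm (Fin 4))).card = 24 := by
      rw [Finset.card_univ, Fintype.card_perm]; rfl
    rwa [h24] at this
  rw [Finset.card_univ, Fintype.card_fun, Fintype.card_fin] at h1
  set n := Fintype.card ι
  have hn : 0 < n := by omega
  have h3 : n ^ 3 * n ≤ n ^ 3 * (25 * m) := by
    calc n ^ 3 * n = n ^ 4 := by ring
      _ ≤ _ := h1
      _ ≤ n ^ 3 * m + 24 * (n ^ 3 * m) := by gcongr
      _ = _ := by ring
  have h4 := Nat.le_of_mul_le_mul_left h3 (by positivity)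
  omega

/-- Pairwise intersecting cylinders in ℝ³: some line meets at least a `1/28`
fraction of them. -/
theorem pairwise_intersecting_cylinders_transversal
    (F : Finset (Set (EuclideanSpace ℝ (Fin 3))))
    (hcyl : ∀ A ∈ F, ∃ (C : Set (EuclideanSpace ℝ (Fin 3)))
      (v : EuclideanSpace ℝ (Fin 3)), C.Nonempty ∧ Convex ℝ C ∧ v ≠ 0 ∧
      A = C + {x : EuclideanSpace ℝ (Fin 3) | ∃ t : ℝ, x = t • v})
    (hpair : ∀ A ∈ F, ∀ B ∈ F, (A ∩ B).Nonempty) :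
    ∃ ℓ : Set (EuclideanSpace ℝ (Fin 3)),
      (∃ p w : EuclideanSpace ℝ (Fin 3), w ≠ 0 ∧
        ℓ = {x : EuclideanSpace ℝ (Fin 3) | ∃ t : ℝ, x = p + t • w}) ∧
      ∃ S ⊆ F, (F.card : ℝ) / 28 ≤ S.card ∧ ∀ A ∈ S, (ℓ ∩ A).Nonempty := by
  classical
  by_contra hcon
  have hline : ∀ p w : PE, w ≠ 0 →
      28 * (F.filter (fun A => PHit p w A)).card < F.card := by
    intro p w hw
    by_contra hlt
    apply hcon
    refine ⟨_, ⟨p, w, hw, rfl⟩, F.filter (fun A => PHit p w A), Finset.filter_subset _ _, ?_, ?_⟩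
    · have : (F.card : ℝ) ≤ 28 * ((F.filter (fun A => PHit p w A)).card : ℝ) := by
        exact_mod_cast not_lt.1 hlt
      linarith
    · intro A hA
      obtain ⟨t, ht⟩ := (Finset.mem_filter.1 hA).2
      exact ⟨p + t • w, ⟨t, rfl⟩, ht⟩
  obtain ⟨w, hw⟩ := exists_ne (0 : PE)
  have h0 := hline 0 w hw
  choose C v hC hCc hv hAe using fun A : F => hcyl A.1 A.2
  have hmem : ∀ (A : F) x, x ∈ (A : Set PE) ↔ ∃ c ∈ C A, ∃ t : ℝ, c + t • v A = x := by
    intro A x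
    rw [hAe A, Set.mem_add]
    constructor
    · rintro ⟨c, hc, _, ⟨t, rfl⟩, rfl⟩; exact ⟨c, hc, t, rfl⟩
    · rintro ⟨c, hc, t, rfl⟩; exact ⟨c, hc, _, ⟨t, rfl⟩, rfl⟩
  refine core (ι := F) (fun A => (A : Set PE)) v ?_ hv ?_ (fun A B => hpair _ A.2 _ B.2)
    ((F.card - 1) / 28) ?_ ?_
  · intro A x hx y hy a b ha hb hab
    obtain ⟨c, hc, t, rfl⟩ := (hmem A x).1 hx
    obtain ⟨d, hd, s, rfl⟩ := (hmem A y).1 hy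
    refine (hmem A _).2 ⟨_, hCc A hc hd ha hb hab, a * t + b * s, ?_⟩
    module
  · intro A x hx s
    obtain ⟨c, hc, t, rfl⟩ := (hmem A x).1 hx
    refine (hmem A _).2 ⟨c, hc, t + s, ?_⟩
    module
  · rw [Fintype.card_coe]; omega
  · intro p w hw
    have h1 := hline p w hw
    have h2 : (Finset.univ.filter (fun A : F => PHit p w (A : Set PE))).card
        ≤ (F.filter (fun A => PHit p w A)).card := by
      apply Finset.card_le_card_of_injOn (fun A : F => (A : Set PE))
      · intro A hA
        simpa using hA
      · intro A _ B _ h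
        exact Subtype.ext h
    omega
end

section
/- Let F and G be finite families of cylinders in ℝ³ with |F| = |G| = n such that A ∩ B ≠ ∅ for every A ∈ F and B ∈ G. Then there is a line intersecting at least n/28 members of F, or a line intersecting at least n/28 members of G. -/
open scoped Pointwise

abbrev E3 := EuclideanSpace ℝ (Fin 3)

lemma planar_tri (P : Finset E3) (hP : P.Nonempty) (f g : E3 → ℝ) :
    ∃ x ∈ P, ∃ y ∈ P, ∃ z ∈ P, ∀ p ∈ P, ∃ α β γ : ℝ, α + β + γ = 1 ∧ α ≤ 1 ∧ β ≤ 1 ∧ γ ≤ 1 ∧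
      f p = α * f x + β * f y + γ * f z ∧ g p = α * g x + β * g y + γ * g z := by
  classical
  let D : E3 → E3 → E3 → ℝ := fun x y z =>
    (f y - f x) * (g z - g x) - (g y - g x) * (f z - f x)
  obtain ⟨⟨x, y, z⟩, hm, hmax⟩ := Finset.exists_max_image (P ×ˢ P ×ˢ P)
    (fun q => |D q.1 q.2.1 q.2.2|) (by simpa using hP)
  simp only [Finset.mem_product] at hm
  have hmax' : ∀ u ∈ P, ∀ v ∈ P, ∀ w ∈ P, |D u v w| ≤ |D x y z| := fun u hu v hv w hw =>
    hmax (u, v, w) (by simp [hu, hv, hw])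
  by_cases h0 : D x y z = 0
  · have hz : ∀ u ∈ P, ∀ v ∈ P, ∀ w ∈ P, D u v w = 0 := fun u hu v hv w hw => by
      have := hmax' u hu v hv w hw
      rw [h0, abs_zero] at this
      exact abs_nonpos_iff.1 this
    obtain ⟨⟨a, b⟩, hm2, hmax2⟩ := Finset.exists_max_image (P ×ˢ P)
      (fun q => (f q.2 - f q.1)^2 + (g q.2 - g q.1)^2) (by simpa using hP)
    simp only [Finset.mem_product] at hm2
    refine ⟨a, hm2.1, b, hm2.2, a, hm2.1, fun p hp => ?_⟩
    have h1 : (f p - f a)^2 + (g p - g a)^2 ≤ (f b - f a)^2 + (g b - g a)^2 :=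
      hmax2 (a, p) (by simp [hm2.1, hp])
    have h2 : (f p - f b)^2 + (g p - g b)^2 ≤ (f b - f a)^2 + (g b - g a)^2 :=
      hmax2 (b, p) (by simp [hm2.2, hp])
    have h3 : (f b - f a) * (g p - g a) - (g b - g a) * (f p - f a) = 0 :=
      hz a hm2.1 b hm2.2 p hp
    set N := (f b - f a)^2 + (g b - g a)^2 with hN
    by_cases hN0 : N = 0
    · refine ⟨1, 0, 0, by norm_num, by norm_num, by norm_num, by norm_num, ?_, ?_⟩ <;>
        nlinarith [sq_nonneg (f p - f a), sq_nonneg (g p - g a)]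
    · have hNp : 0 < N := lt_of_le_of_ne (by positivity) (Ne.symm hN0)
      set t := ((f b - f a) * (f p - f a) + (g b - g a) * (g p - g a)) / N with ht
      have htN : t * N = (f b - f a) * (f p - f a) + (g b - g a) * (g p - g a) := by
        rw [ht]; field_simp
      have e1 : f p - f a = t * (f b - f a) := by
        apply mul_right_cancel₀ hN0
        linear_combination (-(g b - g a)) * h3 + (f p - f a) * hN - (f b - f a) * htN
      have e2 : g p - g a = t * (g b - g a) := by
        apply mul_right_cancel₀ hN0
        linear_combination ((f b - f a)) * h3 + (g p - g a) * hN - (g b - g a) * htN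
      have q1 : t^2 * N ≤ 1 * N := by
        rw [e1, e2] at h1
        linarith [show t^2 * N = (t * (f b - f a))^2 + (t * (g b - g a))^2 by rw [hN]; ring]
      have q2 : (1-t)^2 * N ≤ 1 * N := by
        have e1' : f p - f b = (t-1) * (f b - f a) := by linarith
        have e2' : g p - g b = (t-1) * (g b - g a) := by linarith
        rw [e1', e2'] at h2
        linarith [show (1-t)^2 * N = ((t-1) * (f b - f a))^2 + ((t-1) * (g b - g a))^2 by
          rw [hN]; ring]
      have q1' := le_of_mul_le_mul_right q1 hNp
      have q2' := le_of_mul_le_mul_right q2 hNp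
      refine ⟨1 - t, t, 0, by ring, by nlinarith, by nlinarith, by norm_num, ?_, ?_⟩
      · linarith
      · linarith
  · refine ⟨x, hm.1, y, hm.2.1, z, hm.2.2, fun p hp => ?_⟩
    have key : ∀ r, |r| ≤ |D x y z| → r / D x y z ≤ 1 := fun r hr => by
      refine (le_abs_self _).trans ?_
      rw [abs_div]
      exact div_le_one_of_le₀ hr (abs_nonneg _)
    refine ⟨D p y z / D x y z, D x p z / D x y z, D x y p / D x y z, ?_,
      key _ (hmax' _ hp _ hm.2.1 _ hm.2.2), key _ (hmax' _ hm.1 _ hp _ hm.2.2),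
      key _ (hmax' _ hm.1 _ hm.2.1 _ hp), ?_, ?_⟩
    · rw [← add_div, ← add_div, div_eq_one_iff_eq h0]; simp only [D]; ring
    · apply mul_right_cancel₀ h0
      have : (D p y z / D x y z * f x + D x p z / D x y z * f y + D x y p / D x y z * f z)
        * D x y z = D p y z * f x + D x p z * f y + D x y p * f z := by field_simp
      rw [this]; simp only [D]; ring
    · apply mul_right_cancel₀ h0
      have : (D p y z / D x y z * g x + D x p z / D x y z * g y + D x y p / D x y z * g z)
        * D x y z = D p y z * g x + D x p z * g y + D x y p * g z := by field_simp
      rw [this]; simp only [D]; ring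

lemma exists_proj (b : E3) (hb : b ≠ 0) : ∃ f g : E3 →ₗ[ℝ] ℝ, f b = 0 ∧ g b = 0 ∧
    ∀ x, f x = 0 → g x = 0 → ∃ t : ℝ, x = t • b := by
  have h1 : Module.finrank ℝ (E3 ⧸ (Submodule.span ℝ {b})) = 2 := by
    have := Submodule.finrank_quotient_add_finrank (Submodule.span ℝ {b})
    rw [finrank_span_singleton hb] at this
    have h3 : Module.finrank ℝ E3 = 3 := by simp
    omega
  let B := Module.finBasisOfFinrankEq ℝ _ h1
  let q := (Submodule.span ℝ {b}).mkQ
  have hq : q b = 0 := by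
    simp only [q, Submodule.mkQ_apply, Submodule.Quotient.mk_eq_zero]
    exact Submodule.mem_span_singleton_self b
  refine ⟨(B.coord 0) ∘ₗ q, (B.coord 1) ∘ₗ q, by simp [hq], by simp [hq], fun x hx hy => ?_⟩
  have : q x = 0 := by
    apply B.repr.injective
    ext i
    fin_cases i
    · simpa using hx
    · simpa using hy
  simp only [q, Submodule.mkQ_apply, Submodule.Quotient.mk_eq_zero] at this
  obtain ⟨t, ht⟩ := Submodule.mem_span_singleton.1 this
  exact ⟨t, ht.symm⟩

lemma exists_tri (P : Finset E3) (hP : P.Nonempty) (b : E3) (hb : b ≠ 0) :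
    ∃ x ∈ P, ∃ y ∈ P, ∃ z ∈ P, ∀ p ∈ P, ∃ α β γ t : ℝ, α + β + γ = 1 ∧ α ≤ 1 ∧ β ≤ 1 ∧ γ ≤ 1 ∧
      p = α • x + β • y + γ • z + t • b := by
  obtain ⟨f, g, hf, hg, h⟩ := exists_proj b hb
  obtain ⟨x, hx, y, hy, z, hz, H⟩ := planar_tri P hP f g
  refine ⟨x, hx, y, hy, z, hz, fun p hp => ?_⟩
  obtain ⟨α, β, γ, h1, h2, h3, h4, h5, h6⟩ := H p hp
  obtain ⟨t, ht⟩ := h (p - (α • x + β • y + γ • z)) (by simp [h5]) (by simp [h6])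
  exact ⟨α, β, γ, t, h1, h2, h3, h4, by rw [← ht]; abel⟩

lemma exists_phi (a b : E3) (hb : b ≠ 0) (hab : ∀ t : ℝ, a ≠ t • b) :
    ∃ φ : E3 →ₗ[ℝ] ℝ, φ a = 0 ∧ φ b = 0 ∧ ∀ x, φ x = 0 → ∃ s t : ℝ, x = s • a + t • b := by
  obtain ⟨f, g, hf, hg, h⟩ := exists_proj b hb
  refine ⟨f a • g - g a • f, by simp [mul_comm], by simp [hf, hg], fun x hx => ?_⟩
  simp only [LinearMap.sub_apply, LinearMap.smul_apply, smul_eq_mul] at hx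
  by_cases h1 : f a = 0
  · have h2 : g a ≠ 0 := fun h2 => by
      obtain ⟨t, ht⟩ := h a h1 h2
      exact hab t ht
    obtain ⟨t, ht⟩ := h (x - (g x / g a) • a) (by
      have : f x = 0 := by
        rw [h1] at hx
        have : g a * f x = 0 := by linarith
        exact (mul_eq_zero.1 this).resolve_left h2
      simp [h1, this]) (by simp [h2])
    exact ⟨g x / g a, t, by rw [← ht]; abel⟩
  · obtain ⟨t, ht⟩ := h (x - (f x / f a) • a) (by simp [h1]) (by
      simp only [map_sub, map_smul, smul_eq_mul]
      field_simp
      linarith)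
    exact ⟨f x / f a, t, by rw [← ht]; abel⟩

lemma exists_indep (b : E3) (hb : b ≠ 0) : ∃ e : E3, e ≠ 0 ∧ ∀ t : ℝ, b ≠ t • e := by
  by_contra! hcon
  have : ∀ x : E3, x ∈ Submodule.span ℝ {b} := fun x => by
    by_cases hx : x = 0
    · rw [hx]; exact Submodule.zero_mem _
    obtain ⟨t, ht⟩ := hcon x hx
    have ht0 : t ≠ 0 := fun h => hb (by rw [ht, h, zero_smul])
    exact Submodule.mem_span_singleton.2 ⟨t⁻¹, by rw [ht, smul_smul, inv_mul_cancel₀ ht0, one_smul]⟩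
  have h1 : Submodule.span ℝ {b} = ⊤ := by
    rw [eq_top_iff]; intro x _; exact this x
  have h2 := finrank_span_singleton (K := ℝ) hb
  rw [h1, finrank_top] at h2
  simp at h2

lemma exists_psi : ∃ (e : E3 → E3) (ψ : E3 → (E3 →ₗ[ℝ] ℝ)), ∀ v, v ≠ 0 → e v ≠ 0 ∧
    ψ v v = 0 ∧ ∀ x, ψ v x = 0 → ∃ s t : ℝ, x = s • v + t • e v := by
  have : ∀ v : E3, ∃ (e : E3) (ψ : E3 →ₗ[ℝ] ℝ), v ≠ 0 → e ≠ 0 ∧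
    ψ v = 0 ∧ ∀ x, ψ x = 0 → ∃ s t : ℝ, x = s • v + t • e := fun v => by
    by_cases hv : v = 0
    · exact ⟨0, 0, fun h => absurd hv h⟩
    obtain ⟨e, he, h⟩ := exists_indep v hv
    obtain ⟨φ, h1, h2, h3⟩ := exists_phi v e he h
    exact ⟨e, φ, fun _ => ⟨he, h1, h3⟩⟩
  choose e ψ h using this
  exact ⟨e, ψ, h⟩

lemma exists_canon : ∃ h : E3 → E3, (∀ v, v ≠ 0 → h v ≠ 0 ∧ h (h v) = h v ∧ ∃ t : ℝ, h v = t • v) ∧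
    ∀ u v, u ≠ 0 → (∃ t : ℝ, u = t • v) → h u = h v := by
  classical
  have : ∀ D : Submodule ℝ E3, ∃ u, (∃ w ∈ D, w ≠ 0) → u ∈ D ∧ u ≠ 0 := fun D => by
    by_cases hD : ∃ w ∈ D, w ≠ 0
    · obtain ⟨w, h⟩ := hD
      exact ⟨w, fun _ => h⟩
    · exact ⟨0, fun h => absurd h hD⟩
  choose k hk using this
  have h2 : ∀ u v : E3, u ≠ 0 → (∃ t : ℝ, u = t • v) →
      k (Submodule.span ℝ {u}) = k (Submodule.span ℝ {v}) := by
    rintro u v hu ⟨t, ht⟩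
    have ht0 : t ≠ 0 := fun h => hu (by rw [ht, h, zero_smul])
    rw [ht, Submodule.span_singleton_smul_eq (IsUnit.mk0 t ht0)]
  refine ⟨fun v => k (Submodule.span ℝ {v}), fun v hv => ?_, h2⟩
  obtain ⟨h3, h4⟩ := hk (Submodule.span ℝ {v}) ⟨v, Submodule.mem_span_singleton_self v, hv⟩
  obtain ⟨t, ht⟩ := Submodule.mem_span_singleton.1 h3
  exact ⟨h4, h2 _ _ h4 ⟨t, ht.symm⟩, t, ht.symm⟩

lemma one_dim_sorted (u v s p lo hi α β γ : ℝ) (huv : u ≤ v) (hvs : v ≤ s)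
    (h1 : α + β + γ = 1) (hα : α ≤ 1) (hβ : β ≤ 1) (hγ : γ ≤ 1)
    (hp : p = α * u + β * v + γ * s) (hlo : lo ≤ p) (hhi : p ≤ hi) (hw : s - u ≤ hi - lo) :
    (lo ≤ u ∧ u ≤ hi) ∨ (lo ≤ s ∧ s ≤ hi) ∨ (lo ≤ v + s - u ∧ v + s - u ≤ hi) ∨
    (lo ≤ u + v - s ∧ u + v - s ≤ hi) := by
  have hα' : α = 1 - β - γ := by linarith
  have hγ' : γ = 1 - α - β := by linarith
  have b1 : p ≤ v + s - u := by
    rw [hp, hα']; nlinarith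
  have b2 : u + v - s ≤ p := by
    rw [hp, hγ']; nlinarith
  by_contra! hc
  obtain ⟨c1, c2, c3, c4⟩ := hc
  have d3 := c3 (by linarith)
  have d4 : u + v - s < lo := by
    by_contra! h; linarith [c4 h]
  have d1 : u < lo := by
    by_contra! h; linarith [c1 h]
  have d2 : s < lo := by
    by_contra! h; linarith [c2 h]
  linarith

def wd (u v s : ℝ) : ℝ := max u (max v s) - min u (min v s)

lemma one_dim (u v s p lo hi α β γ : ℝ)
    (h1 : α + β + γ = 1) (hα : α ≤ 1) (hβ : β ≤ 1) (hγ : γ ≤ 1)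
    (hp : p = α * u + β * v + γ * s) (hlo : lo ≤ p) (hhi : p ≤ hi) (hw : wd u v s ≤ hi - lo) :
    (lo ≤ u ∧ u ≤ hi) ∨ (lo ≤ v ∧ v ≤ hi) ∨ (lo ≤ s ∧ s ≤ hi) ∨
    (lo ≤ v + s - u ∧ v + s - u ≤ hi) ∨ (lo ≤ u + s - v ∧ u + s - v ≤ hi) ∨
    (lo ≤ u + v - s ∧ u + v - s ≤ hi) := by
  have g1 : ∀ x ∈ [u,v,s], ∀ y ∈ [u,v,s], x - y ≤ hi - lo := by
    intro x hx y hy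
    have : x ≤ max u (max v s) := by simp at hx ⊢; grind
    have : min u (min v s) ≤ y := by simp at hy ⊢; grind
    unfold wd at hw
    linarith
  simp only [List.mem_cons, List.not_mem_nil, or_false, forall_eq_or_imp, forall_eq] at g1
  obtain ⟨⟨-, g2, g3⟩, ⟨g4, -, g5⟩, g6, g7, -⟩ := g1
  rcases le_total u v with a | a <;> rcases le_total v s with b | b <;>
    rcases le_total u s with c | c
  · have := one_dim_sorted u v s p lo hi α β γ a b (by linarith) hα hβ hγ (by linarith) hlo hhi g6
    grind
  · have := one_dim_sorted u v s p lo hi α β γ a b (by linarith) hα hβ hγ (by linarith) hlo hhi g6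
    grind
  · have := one_dim_sorted u s v p lo hi α γ β c b (by linarith) hα hγ hβ (by linarith) hlo hhi g4
    grind
  · have := one_dim_sorted s u v p lo hi γ α β c a (by linarith) hγ hα hβ (by linarith) hlo hhi g5
    grind
  · have := one_dim_sorted v u s p lo hi β α γ a c (by linarith) hβ hα hγ (by linarith) hlo hhi g7
    grind
  · have := one_dim_sorted v s u p lo hi β γ α b c (by linarith) hβ hγ hα (by linarith) hlo hhi g2
    grind
  · have := one_dim_sorted s v u p lo hi γ β α b a (by linarith) hγ hβ hα (by linarith) hlo hhi g3
    grind
  · have := one_dim_sorted s v u p lo hi γ β α b a (by linarith) hγ hβ hα (by linarith) hlo hhi g3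
    grind

def Meets (A : Set E3) (l : E3 × E3) : Prop := ∃ t : ℝ, l.1 + t • l.2 ∈ A

def lns (e : E3 → E3) (b x y z m : E3) : Fin 7 → E3 × E3 :=
  ![(x, b), (y, b), (z, b), (y + z - x, b), (x + z - y, b), (x + y - z, b), (m, e b)]

structure Good (h e : E3 → E3) (ψ : E3 → (E3 →ₗ[ℝ] ℝ)) (A : Set E3) (P : Finset E3)
    (a x y z m : E3) : Prop where
  ha : a ≠ 0
  hh : h a = a
  conv : Convex ℝ A
  inv : ∀ q ∈ A, ∀ t : ℝ, q + t • a ∈ A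
  hx : x ∈ A
  hy : y ∈ A
  hz : z ∈ A
  hm : m ∈ A
  tri : ∀ p ∈ P, ∃ α β γ t : ℝ, α + β + γ = 1 ∧ α ≤ 1 ∧ β ≤ 1 ∧ γ ≤ 1 ∧
      p = α • x + β • y + γ • z + t • a
  min : ∀ p ∈ P, ψ a m ≤ ψ a p

lemma conv_val (A : Set E3) (hA : Convex ℝ A) (φ : E3 →ₗ[ℝ] ℝ) (q1 q2 : E3) (h1 : q1 ∈ A)
    (h2 : q2 ∈ A) (c : ℝ) (hc1 : φ q1 ≤ c) (hc2 : c ≤ φ q2) : ∃ y ∈ A, φ y = c := by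
  have := (hA.linear_image φ).ordConnected.out (Set.mem_image_of_mem φ h1)
    (Set.mem_image_of_mem φ h2) ⟨hc1, hc2⟩
  exact this

lemma wd_att (A : Set E3) (φ : E3 →ₗ[ℝ] ℝ) (x y z : E3) (hx : x ∈ A) (hy : y ∈ A) (hz : z ∈ A) :
    ∃ q1 ∈ A, ∃ q2 ∈ A, wd (φ x) (φ y) (φ z) = φ q2 - φ q1 := by
  have h1 : ∃ q ∈ A, φ q = max (φ x) (max (φ y) (φ z)) := by
    rcases max_choice (φ x) (max (φ y) (φ z)) with h | h <;> rw [h]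
    · exact ⟨x, hx, rfl⟩
    rcases max_choice (φ y) (φ z) with h | h <;> rw [h]
    · exact ⟨y, hy, rfl⟩
    · exact ⟨z, hz, rfl⟩
  have h2 : ∃ q ∈ A, φ q = min (φ x) (min (φ y) (φ z)) := by
    rcases min_choice (φ x) (min (φ y) (φ z)) with h | h <;> rw [h]
    · exact ⟨x, hx, rfl⟩
    rcases min_choice (φ y) (φ z) with h | h <;> rw [h]
    · exact ⟨y, hy, rfl⟩
    · exact ⟨z, hz, rfl⟩
  obtain ⟨q2, h3, h4⟩ := h1
  obtain ⟨q1, h5, h6⟩ := h2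
  exact ⟨q1, h5, q2, h3, by rw [h4, h6, wd]⟩

lemma half_nonpar {h e : E3 → E3} {ψ : E3 → (E3 →ₗ[ℝ] ℝ)} {A B : Set E3} {P Q : Finset E3}
    {a x y z m b x' y' z' m' p : E3} (hA : Good h e ψ A P a x y z m)
    (hB : Good h e ψ B Q b x' y' z' m') (φ : E3 →ₗ[ℝ] ℝ) (hb : φ b = 0)
    (hφ : ∀ x, φ x = 0 → ∃ s t : ℝ, x = s • a + t • b) (hpA : p ∈ A) (hpQ : p ∈ Q)
    (hw : wd (φ x') (φ y') (φ z') ≤ wd (φ x) (φ y) (φ z)) :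
    ∃ i, Meets A (lns e b x' y' z' m' i) := by
  obtain ⟨q1, h1, q2, h2, hq⟩ := wd_att A φ x y z hA.hx hA.hy hA.hz
  obtain ⟨α, β, γ, t, k1, k2, k3, k4, k5⟩ := hB.tri p hpQ
  have k6 : φ p = α * φ x' + β * φ y' + γ * φ z' := by rw [k5]; simp [hb]
  have hlo : ∃ r ∈ A, φ r = min (φ q1) (φ p) := by
    rcases min_choice (φ q1) (φ p) with h | h <;> rw [h]
    exacts [⟨q1, h1, rfl⟩, ⟨p, hpA, rfl⟩]
  have hhi : ∃ r ∈ A, φ r = max (φ q2) (φ p) := by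
    rcases max_choice (φ q2) (φ p) with h | h <;> rw [h]
    exacts [⟨q2, h2, rfl⟩, ⟨p, hpA, rfl⟩]
  obtain ⟨r1, r1A, hr1⟩ := hlo
  obtain ⟨r2, r2A, hr2⟩ := hhi
  have l1 : φ r1 ≤ φ p := hr1 ▸ min_le_right _ _
  have l2 : φ p ≤ φ r2 := hr2 ▸ le_max_right _ _
  have l3 : φ r1 ≤ φ q1 := hr1 ▸ min_le_left _ _
  have l4 : φ q2 ≤ φ r2 := hr2 ▸ le_max_left _ _
  have key : ∀ c : E3, φ r1 ≤ φ c ∧ φ c ≤ φ r2 → Meets A (c, b) := by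
    rintro c ⟨c1, c2⟩
    obtain ⟨w, hw, hwc⟩ := conv_val A hA.conv φ r1 r2 r1A r2A _ c1 c2
    obtain ⟨s, t, hst⟩ := hφ (w - c) (by simp [hwc])
    refine ⟨t, ?_⟩
    have := hA.inv w hw (-s)
    convert this using 1
    have : w = c + (s • a + t • b) := by rw [← hst]; abel
    simp only [this, neg_smul]; abel
  rcases one_dim _ _ _ _ (φ r1) (φ r2) α β γ k1 k2 k3 k4 k6 l1 l2 (by linarith) with
    o | o | o | o | o | o
  · exact ⟨0, key _ o⟩
  · exact ⟨1, key _ o⟩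
  · exact ⟨2, key _ o⟩
  · exact ⟨3, key (y' + z' - x') (by simpa using o)⟩
  · exact ⟨4, key (x' + z' - y') (by simpa using o)⟩
  · exact ⟨5, key (x' + y' - z') (by simpa using o)⟩

lemma half_par {h e : E3 → E3} {ψ : E3 → (E3 →ₗ[ℝ] ℝ)} {A B : Set E3} {P Q : Finset E3}
    {a x y z m x' y' z' m' p : E3} (hA : Good h e ψ A P a x y z m)
    (hB : Good h e ψ B Q a x' y' z' m')
    (hψ : ∀ x, ψ a x = 0 → ∃ s t : ℝ, x = s • a + t • e a) (hpA : p ∈ A) (hpQ : p ∈ Q)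
    (hw : ψ a m ≤ ψ a m') :
    ∃ i, Meets A (lns e a x' y' z' m' i) := by
  refine ⟨6, ?_⟩
  change Meets A (m', e a)
  obtain ⟨w, hw, hwc⟩ := conv_val A hA.conv (ψ a) m p hA.hm hpA _ hw (hB.min p hpQ)
  obtain ⟨s, t, hst⟩ := hψ (w - m') (by simp [hwc])
  refine ⟨t, ?_⟩
  have := hA.inv w hw (-s)
  convert this using 1
  have : w = m' + (s • a + t • e a) := by rw [← hst]; abel
  simp only [this, neg_smul]; abel

lemma pair_lemma {h e : E3 → E3} {ψ : E3 → (E3 →ₗ[ℝ] ℝ)}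
    (hh : ∀ u v, u ≠ 0 → (∃ t : ℝ, u = t • v) → h u = h v)
    (hψ : ∀ v, v ≠ 0 → e v ≠ 0 ∧
      ψ v v = 0 ∧ ∀ x, ψ v x = 0 → ∃ s t : ℝ, x = s • v + t • e v)
    {A B : Set E3} {P Q : Finset E3}
    {a x y z m b x' y' z' m' p : E3} (hA : Good h e ψ A P a x y z m)
    (hB : Good h e ψ B Q b x' y' z' m') (hpA : p ∈ A) (hpB : p ∈ B) (hpP : p ∈ P) (hpQ : p ∈ Q) :
    (∃ i, Meets A (lns e b x' y' z' m' i)) ∨ (∃ i, Meets B (lns e a x y z m i)) := by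
  by_cases hab : ∃ t : ℝ, a = t • b
  · have : a = b := by rw [← hA.hh, ← hB.hh]; exact hh a b hA.ha hab
    subst this
    rcases le_total (ψ a m) (ψ a m') with o | o
    · exact Or.inl (half_par hA hB (hψ a hA.ha).2.2 hpA hpQ o)
    · exact Or.inr (half_par hB hA (hψ a hA.ha).2.2 hpB hpP o)
  · push Not at hab
    obtain ⟨φ, h1, h2, h3⟩ := exists_phi a b hB.ha hab
    rcases le_total (wd (φ x') (φ y') (φ z')) (wd (φ x) (φ y) (φ z)) with o | o
    · exact Or.inl (half_nonpar hA hB φ h2 h3 hpA hpQ o)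
    · refine Or.inr (half_nonpar hB hA φ h1 (fun q hq => ?_) hpB hpP o)
      obtain ⟨s, t, hst⟩ := h3 q hq
      exact ⟨t, s, by rw [hst, add_comm]⟩

lemma exists_good {h e : E3 → E3} {ψ : E3 → (E3 →ₗ[ℝ] ℝ)}
    (hh : ∀ v, v ≠ 0 → h v ≠ 0 ∧ h (h v) = h v ∧ ∃ t : ℝ, h v = t • v)
    (A : Set E3) (P : Finset E3) (hP : P.Nonempty) (hPA : ∀ p ∈ P, p ∈ A)
    (hA : ∃ (C : Set E3) (v : E3), C.Nonempty ∧ Convex ℝ C ∧ v ≠ 0 ∧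
      A = C + {x : E3 | ∃ t : ℝ, x = t • v}) :
    ∃ a x y z m, Good h e ψ A P a x y z m := by
  obtain ⟨C, v, -, hC, hv, rfl⟩ := hA
  obtain ⟨h1, h2, t, ht⟩ := hh v hv
  obtain ⟨x, hx, y, hy, z, hz, H⟩ := exists_tri P hP (h v) h1
  obtain ⟨m, hm, Hm⟩ := Finset.exists_min_image P (fun p => ψ (h v) p) hP
  refine ⟨h v, x, y, z, m, h1, h2, ?_, ?_, hPA _ hx, hPA _ hy, hPA _ hz, hPA _ hm, H, Hm⟩
  · apply hC.add
    rintro _ ⟨s, rfl⟩ _ ⟨r, rfl⟩ α β _ _ _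
    exact ⟨α * s + β * r, by rw [add_smul, mul_smul, mul_smul]⟩
  · rintro _ ⟨c, hc, _, ⟨s, rfl⟩, rfl⟩ r
    refine ⟨c, hc, _, ⟨s + r * t, rfl⟩, ?_⟩
    simp only [ht, add_smul, mul_smul, add_assoc]

lemma exists_lines {h e : E3 → E3} {ψ : E3 → (E3 →ₗ[ℝ] ℝ)}
    (hψ : ∀ v, v ≠ 0 → e v ≠ 0 ∧
      ψ v v = 0 ∧ ∀ x, ψ v x = 0 → ∃ s t : ℝ, x = s • v + t • e v)
    {A : Set E3} {P : Finset E3} {a x y z m : E3} (hA : Good h e ψ A P a x y z m) :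
    ∀ i, (lns e a x y z m i).2 ≠ 0 := by
  intro i
  have := hA.ha
  have := (hψ a hA.ha).1
  fin_cases i <;> simpa [lns]

lemma all_lines (F G : Finset (Set E3)) (hFn : F.Nonempty) (hGn : G.Nonempty)
    (hcylF : ∀ A ∈ F, ∃ (C : Set E3) (v : E3), C.Nonempty ∧ Convex ℝ C ∧ v ≠ 0 ∧
      A = C + {x : E3 | ∃ t : ℝ, x = t • v})
    (hcylG : ∀ A ∈ G, ∃ (C : Set E3) (v : E3), C.Nonempty ∧ Convex ℝ C ∧ v ≠ 0 ∧
      A = C + {x : E3 | ∃ t : ℝ, x = t • v})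
    (hpair : ∀ A ∈ F, ∀ B ∈ G, (A ∩ B).Nonempty) :
    ∃ L M : Set E3 → Fin 7 → E3 × E3, (∀ A ∈ F, ∀ i, (L A i).2 ≠ 0) ∧
      (∀ B ∈ G, ∀ i, (M B i).2 ≠ 0) ∧
      ∀ A ∈ F, ∀ B ∈ G, (∃ i, Meets A (M B i)) ∨ (∃ i, Meets B (L A i)) := by
  classical
  obtain ⟨h, hh1, hh2⟩ := exists_canon
  obtain ⟨e, ψ, hψ⟩ := exists_psi
  have : ∀ A B : Set E3, ∃ p, (A ∩ B).Nonempty → p ∈ A ∩ B := fun A B => by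
    by_cases hAB : (A ∩ B).Nonempty
    · exact ⟨hAB.some, fun _ => hAB.some_mem⟩
    · exact ⟨0, fun h => absurd h hAB⟩
  choose p hp using this
  have hF : ∀ A : Set E3, ∃ a x y z m, A ∈ F → Good h e ψ A (G.image (p A)) a x y z m := fun A => by
    by_cases hA : A ∈ F
    · obtain ⟨a, x, y, z, m, H⟩ := exists_good (e := e) (ψ := ψ) hh1 A (G.image (p A))
        (hGn.image _) (by
          intro q hq
          obtain ⟨B, hB, rfl⟩ := Finset.mem_image.1 hq
          exact (hp A B (hpair A hA B hB)).1) (hcylF A hA)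
      exact ⟨a, x, y, z, m, fun _ => H⟩
    · exact ⟨0, 0, 0, 0, 0, fun h => absurd h hA⟩
  have hG : ∀ B : Set E3, ∃ a x y z m, B ∈ G →
      Good h e ψ B (F.image (fun A => p A B)) a x y z m := fun B => by
    by_cases hB : B ∈ G
    · obtain ⟨a, x, y, z, m, H⟩ := exists_good (e := e) (ψ := ψ) hh1 B (F.image (fun A => p A B))
        (hFn.image _) (by
          intro q hq
          obtain ⟨A, hA, rfl⟩ := Finset.mem_image.1 hq
          exact (hp A B (hpair A hA B hB)).2) (hcylG B hB)
      exact ⟨a, x, y, z, m, fun _ => H⟩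
    · exact ⟨0, 0, 0, 0, 0, fun h => absurd h hB⟩
  choose a x y z m HF using hF
  choose a' x' y' z' m' HG using hG
  refine ⟨fun A => lns e (a A) (x A) (y A) (z A) (m A),
    fun A => lns e (a' A) (x' A) (y' A) (z' A) (m' A),
    fun A hA => exists_lines hψ (HF A hA), fun B hB => exists_lines hψ (HG B hB),
    fun A hA B hB => ?_⟩
  have hq := hp A B (hpair A hA B hB)
  exact pair_lemma hh2 hψ (HF A hA) (HG B hB) hq.1 hq.2
    (Finset.mem_image_of_mem _ hB) (Finset.mem_image.2 ⟨A, hA, rfl⟩)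

lemma concl (n : ℕ) (F : Finset (Set E3)) (l : E3 × E3) (hl : l.2 ≠ 0) (S : Finset (Set E3))
    (hS : S ⊆ F) (hc : (n : ℝ) / 28 ≤ S.card) (hm : ∀ A ∈ S, Meets A l) :
    ∃ ℓ : Set E3, (∃ p w : E3, w ≠ 0 ∧ ℓ = {x : E3 | ∃ t : ℝ, x = p + t • w}) ∧
      ∃ S ⊆ F, (n : ℝ) / 28 ≤ S.card ∧ ∀ A ∈ S, (ℓ ∩ A).Nonempty := by
  refine ⟨_, ⟨l.1, l.2, hl, rfl⟩, S, hS, hc, fun A hA => ?_⟩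
  obtain ⟨t, ht⟩ := hm A hA
  exact ⟨_, ⟨t, rfl⟩, ht⟩

/-- Bipartite version: two families of `n` cylinders in ℝ³ with every member of
the first meeting every member of the second; some line meets at least `n/28`
members of one of the families. -/
theorem bipartite_cylinders_transversal (n : ℕ)
    (F G : Finset (Set (EuclideanSpace ℝ (Fin 3))))
    (hF : F.card = n) (hG : G.card = n)
    (hcylF : ∀ A ∈ F, ∃ (C : Set (EuclideanSpace ℝ (Fin 3)))
      (v : EuclideanSpace ℝ (Fin 3)), C.Nonempty ∧ Convex ℝ C ∧ v ≠ 0 ∧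
      A = C + {x : EuclideanSpace ℝ (Fin 3) | ∃ t : ℝ, x = t • v})
    (hcylG : ∀ B ∈ G, ∃ (C : Set (EuclideanSpace ℝ (Fin 3)))
      (v : EuclideanSpace ℝ (Fin 3)), C.Nonempty ∧ Convex ℝ C ∧ v ≠ 0 ∧
      B = C + {x : EuclideanSpace ℝ (Fin 3) | ∃ t : ℝ, x = t • v})
    (hpair : ∀ A ∈ F, ∀ B ∈ G, (A ∩ B).Nonempty) :
    (∃ ℓ : Set (EuclideanSpace ℝ (Fin 3)),
      (∃ p w : EuclideanSpace ℝ (Fin 3), w ≠ 0 ∧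
        ℓ = {x : EuclideanSpace ℝ (Fin 3) | ∃ t : ℝ, x = p + t • w}) ∧
      ∃ S ⊆ F, (n : ℝ) / 28 ≤ S.card ∧ ∀ A ∈ S, (ℓ ∩ A).Nonempty) ∨
    (∃ ℓ : Set (EuclideanSpace ℝ (Fin 3)),
      (∃ p w : EuclideanSpace ℝ (Fin 3), w ≠ 0 ∧
        ℓ = {x : EuclideanSpace ℝ (Fin 3) | ∃ t : ℝ, x = p + t • w}) ∧
      ∃ S ⊆ G, (n : ℝ) / 28 ≤ S.card ∧ ∀ B ∈ S, (ℓ ∩ B).Nonempty) := by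

  classical
  rcases Nat.eq_zero_or_pos n with hn | hn
  · left
    obtain ⟨e, he, -⟩ := exists_indep (EuclideanSpace.single 0 1) (by simp)
    exact concl n F (0, e) he ∅ (by simp) (by simp [hn]) (by simp)
  have hFn : F.Nonempty := Finset.card_pos.1 (by omega)
  have hGn : G.Nonempty := Finset.card_pos.1 (by omega)
  obtain ⟨L, M, hL, hM, H⟩ := all_lines F G hFn hGn hcylF hcylG hpair
  by_contra hcon
  rw [not_or] at hcon
  obtain ⟨c1, c2⟩ := hcon
  have d1 : ∀ B ∈ G, ∀ i, ((F.filter (fun A => Meets A (M B i))).card : ℝ) ≤ n / 28 := by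
    intro B hB i
    by_contra! hlt
    exact c1 (concl n F (M B i) (hM B hB i) _ (Finset.filter_subset _ _) hlt.le
      (fun A hA => (Finset.mem_filter.1 hA).2))
  have d2 : ∀ A ∈ F, ∀ i, ((G.filter (fun B => Meets B (L A i))).card : ℝ) ≤ n / 28 := by
    intro A hA i
    by_contra! hlt
    exact c2 (concl n G (L A i) (hL A hA i) _ (Finset.filter_subset _ _) hlt.le
      (fun B hB => (Finset.mem_filter.1 hB).2))
  have hle : ∑ A ∈ F, ∑ B ∈ G, (1 : ℝ) ≤
      ∑ A ∈ F, ∑ B ∈ G, ((∑ i : Fin 7, if Meets A (M B i) then (1 : ℝ) else 0) +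
        ∑ i : Fin 7, if Meets B (L A i) then (1 : ℝ) else 0) := by
    refine Finset.sum_le_sum fun A hA => Finset.sum_le_sum fun B hB => ?_
    have n1 : ∀ i ∈ Finset.univ, (0 : ℝ) ≤ if Meets A (M B i) then (1 : ℝ) else 0 :=
      fun i _ => by split_ifs <;> norm_num
    have n2 : ∀ i ∈ Finset.univ, (0 : ℝ) ≤ if Meets B (L A i) then (1 : ℝ) else 0 :=
      fun i _ => by split_ifs <;> norm_num
    have s1 := Finset.sum_nonneg n1
    have s2 := Finset.sum_nonneg n2
    rcases H A hA B hB with ⟨i, hi⟩ | ⟨i, hi⟩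
    · have := Finset.single_le_sum n1 (Finset.mem_univ i)
      rw [if_pos hi] at this
      linarith
    · have := Finset.single_le_sum n2 (Finset.mem_univ i)
      rw [if_pos hi] at this
      linarith
  have e1 : ∑ A ∈ F, ∑ B ∈ G, (∑ i : Fin 7, if Meets A (M B i) then (1 : ℝ) else 0) ≤
      n * (7 * (n / 28)) := by
    rw [Finset.sum_comm]
    calc _ ≤ ∑ B ∈ G, (7 * ((n : ℝ) / 28)) := by
          refine Finset.sum_le_sum fun B hB => ?_
          rw [Finset.sum_comm]
          calc _ ≤ ∑ i : Fin 7, ((n : ℝ) / 28) := by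
                refine Finset.sum_le_sum fun i _ => ?_
                simpa using d1 B hB i
            _ = _ := by simp
      _ = _ := by simp [hG]
  have e2 : ∑ A ∈ F, ∑ B ∈ G, (∑ i : Fin 7, if Meets B (L A i) then (1 : ℝ) else 0) ≤
      n * (7 * (n / 28)) := by
    calc _ ≤ ∑ A ∈ F, (7 * ((n : ℝ) / 28)) := by
          refine Finset.sum_le_sum fun A hA => ?_
          rw [Finset.sum_comm]
          calc _ ≤ ∑ i : Fin 7, ((n : ℝ) / 28) := by
                refine Finset.sum_le_sum fun i _ => ?_
                simpa using d2 A hA i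
            _ = _ := by simp
      _ = _ := by simp [hF]
  simp only [Finset.sum_add_distrib] at hle
  have e3 : ∑ A ∈ F, ∑ B ∈ G, (1 : ℝ) = n * n := by simp [hF, hG]
  have hn' : (0 : ℝ) < n := by exact_mod_cast hn
  nlinarith
end

section
/- Let D ≥ 1 and let F be a finite family of convex bodies in ℝ³ such that any two members intersect and each A ∈ F is well-rounded with parameter D, i.e., there exist concentric balls G(a,r) ⊆ A ⊆ G(a,R) with r < R < Dr. Then there exists a set L of at most 32D² lines such that every A ∈ F is intersected by some line of L. -/
lemma wr_grid (k : ℕ) (hk : 0 < k) (x : ℝ) (h1 : -1 ≤ x) (h2 : x ≤ 1) :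
    ∃ j : Fin k, (x - (2 * (j : ℕ) + 1 - k) / k) ^ 2 ≤ 1 / (k : ℝ) ^ 2 := by
  have hk' : (0 : ℝ) < k := by exact_mod_cast hk
  have hy : 0 ≤ (x + 1) * k / 2 := by
    have : 0 ≤ x + 1 := by linarith
    positivity
  have key : ∃ j : ℕ, j < k ∧ (j : ℝ) ≤ (x + 1) * k / 2 ∧ (x + 1) * k / 2 ≤ j + 1 := by
    by_cases h : ⌊(x + 1) * k / 2⌋₊ < k
    · exact ⟨_, h, Nat.floor_le hy, (Nat.lt_floor_add_one _).le⟩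
    · have h3 : (k : ℝ) ≤ (x + 1) * k / 2 := (Nat.le_floor_iff hy).1 (not_lt.1 h)
      refine ⟨k - 1, by omega, ?_, ?_⟩
      · rw [Nat.cast_sub hk]; push_cast; linarith
      · rw [Nat.cast_sub hk]; push_cast; nlinarith
  obtain ⟨j, hj, ha, hb⟩ := key
  refine ⟨⟨j, hj⟩, ?_⟩
  have : x - (2 * (j : ℝ) + 1 - k) / k = ((x + 1) * k - 2 * j - 1) / k := by
    field_simp; ring
  simp only [this, div_pow]
  gcongr
  nlinarith

lemma wr_arith (D : ℝ) (hD : 1 ≤ D) : ∃ k l : ℕ, 0 < k ∧ 0 < l ∧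
    3 * (k : ℝ) * l ≤ 32 * D ^ 2 ∧ 4 * D ^ 2 * ((k : ℝ) ^ 2 + l ^ 2) ≤ (k : ℝ) ^ 2 * l ^ 2 := by
  have h0 : 1 ≤ D ^ 2 := by nlinarith
  by_cases h : 49 / 8 < D ^ 2
  · have hs : Real.sqrt 8 * D = Real.sqrt (8 * D ^ 2) := by
      rw [Real.sqrt_mul (by norm_num), Real.sqrt_sq (by linarith)]
    set s := Real.sqrt (8 * D ^ 2) with hsd
    have s2 : s ^ 2 = 8 * D ^ 2 := Real.sq_sqrt (by positivity)
    have s7 : 7 ≤ s := Real.le_sqrt_of_sq_le (by linarith)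
    have c1 : s ≤ ⌈s⌉₊ := Nat.le_ceil s
    have c2 : (⌈s⌉₊ : ℝ) < s + 1 := Nat.ceil_lt_add_one (by linarith)
    have hp : 0 < ⌈s⌉₊ := Nat.ceil_pos.2 (by linarith)
    refine ⟨⌈s⌉₊, ⌈s⌉₊, hp, hp, by nlinarith, ?_⟩
    have : 8 * D ^ 2 ≤ (⌈s⌉₊ : ℝ) ^ 2 := by nlinarith
    nlinarith [sq_nonneg (⌈s⌉₊ : ℝ)]
  push Not at h
  by_cases h1 : D ^ 2 ≤ 9 / 8
  · exact ⟨3, 3, by norm_num, by norm_num, by norm_num; linarith, by norm_num; linarith⟩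
  by_cases h2 : D ^ 2 ≤ 36 / 25
  · exact ⟨3, 4, by norm_num, by norm_num, by norm_num; linarith, by norm_num; linarith⟩
  by_cases h3 : D ^ 2 ≤ 8 / 5
  · exact ⟨3, 5, by norm_num, by norm_num, by norm_num; linarith, by norm_num; linarith⟩
  by_cases h4 : D ^ 2 ≤ 2
  · exact ⟨4, 4, by norm_num, by norm_num, by norm_num; linarith, by norm_num; linarith⟩
  by_cases h5 : D ^ 2 ≤ 2.4
  · exact ⟨4, 5, by norm_num, by norm_num, by norm_num; linarith, by norm_num at *; linarith⟩
  by_cases h6 : D ^ 2 ≤ 3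
  · exact ⟨5, 5, by norm_num, by norm_num, by norm_num at *; linarith, by norm_num; linarith⟩
  by_cases h7 : D ^ 2 ≤ 3.6
  · exact ⟨5, 6, by norm_num, by norm_num, by norm_num; linarith, by norm_num at *; linarith⟩
  by_cases h8 : D ^ 2 ≤ 4.5
  · exact ⟨6, 6, by norm_num, by norm_num, by norm_num at *; linarith, by norm_num at *; linarith⟩
  by_cases h9 : D ^ 2 ≤ 5
  · exact ⟨6, 7, by norm_num, by norm_num, by norm_num at *; linarith, by norm_num; linarith⟩
  · exact ⟨7, 7, by norm_num, by norm_num, by norm_num; linarith, by norm_num; linarith⟩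

noncomputable def wrDir (k l : ℕ) (z : Fin 3 × Fin k × Fin l) : EuclideanSpace ℝ (Fin 3) :=
  WithLp.toLp 2 (fun c => if c = z.1 then 1 else if c = z.1 + 1
    then (2 * (z.2.1 : ℕ) + 1 - k) / k else (2 * (z.2.2 : ℕ) + 1 - l) / l)

lemma wr_dir (k l : ℕ) (hk : 0 < k) (hl : 0 < l) (v : EuclideanSpace ℝ (Fin 3)) :
    ∃ z : Fin 3 × Fin k × Fin l, ∃ t : ℝ,
      ‖v - t • wrDir k l z‖ ^ 2 ≤ ‖v‖ ^ 2 * (1 / (k : ℝ) ^ 2 + 1 / (l : ℝ) ^ 2) := by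
  obtain ⟨i, hi⟩ := Finite.exists_max (fun i => |v i|)
  by_cases h0 : v i = 0
  · have hv : v = 0 := by
      ext c
      have := hi c
      simpa [h0] using this
    exact ⟨⟨0, ⟨0, hk⟩, ⟨0, hl⟩⟩, 0, by simp [hv]⟩
  have hq : ∀ c, -1 ≤ v c / v i ∧ v c / v i ≤ 1 := by
    intro c
    rw [← abs_le, abs_div, div_le_one (abs_pos.2 h0)]
    exact hi c
  obtain ⟨a, ha⟩ := wr_grid k hk _ (hq (i + 1)).1 (hq (i + 1)).2
  obtain ⟨b, hb⟩ := wr_grid l hl _ (hq (i + 2)).1 (hq (i + 2)).2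
  refine ⟨⟨i, a, b⟩, v i, ?_⟩
  have e : ∀ (x g : ℝ), (x - v i * g) ^ 2 = (v i) ^ 2 * (x / v i - g) ^ 2 := by
    intro x g; field_simp
  have hle : (v i) ^ 2 ≤ ‖v‖ ^ 2 := by
    rw [EuclideanSpace.norm_sq_eq]
    have := Finset.single_le_sum (f := fun c => ‖v c‖ ^ 2) (fun c _ => sq_nonneg _)
      (Finset.mem_univ i)
    simpa using this
  have hmain : ‖v - v i • wrDir k l ⟨i, a, b⟩‖ ^ 2 =
      (v (i + 1) - v i * ((2 * (a : ℕ) + 1 - k) / k)) ^ 2 +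
      (v (i + 2) - v i * ((2 * (b : ℕ) + 1 - l) / l)) ^ 2 := by
    rw [EuclideanSpace.norm_sq_eq, Fin.sum_univ_three]
    fin_cases i <;> simp [wrDir] <;> ring
  rw [hmain, e, e, ← mul_add]
  gcongr

lemma wr_dir_ne (k l : ℕ) (z : Fin 3 × Fin k × Fin l) : wrDir k l z ≠ 0 := by
  intro h
  have := congrArg (fun x : EuclideanSpace ℝ (Fin 3) => x z.1) h
  simp [wrDir] at this


/-- A pairwise intersecting finite family of convex bodies in ℝ³, each
well-rounded with parameter `D`, is pierced by a set of at most `32·D²` lines. -/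
theorem well_rounded_family_line_piercing (D : ℝ) (hD : 1 ≤ D)
    (F : Finset (Set (EuclideanSpace ℝ (Fin 3))))
    (hconv : ∀ A ∈ F, Convex ℝ A) (hcomp : ∀ A ∈ F, IsCompact A)
    (hint : ∀ A ∈ F, (interior A).Nonempty)
    (hpair : ∀ A ∈ F, ∀ B ∈ F, (A ∩ B).Nonempty)
    (hround : ∀ A ∈ F, ∃ (a : EuclideanSpace ℝ (Fin 3)) (r R : ℝ),
      0 < r ∧ r < R ∧ R < D * r ∧
      Metric.closedBall a r ⊆ A ∧ A ⊆ Metric.closedBall a R) :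
    ∃ L : Finset (Set (EuclideanSpace ℝ (Fin 3))),
      (L.card : ℝ) ≤ 32 * D ^ 2 ∧
      (∀ ℓ ∈ L, ∃ p w : EuclideanSpace ℝ (Fin 3), w ≠ 0 ∧
        ℓ = {x : EuclideanSpace ℝ (Fin 3) | ∃ t : ℝ, x = p + t • w}) ∧
      ∀ A ∈ F, ∃ ℓ ∈ L, (ℓ ∩ A).Nonempty := by
  classical
  choose! a r R hr hrR hRD hin hout using hround
  obtain rfl | hne := F.eq_empty_or_nonempty
  · exact ⟨∅, by simp; positivity, by simp, by simp⟩
  obtain ⟨A₀, hA₀, hmin⟩ := F.exists_min_image R hne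
  obtain ⟨k, l, hk, hl, hcard, hkl⟩ := wr_arith D hD
  refine ⟨Finset.univ.image (fun z : Fin 3 × Fin k × Fin l =>
    {x : EuclideanSpace ℝ (Fin 3) | ∃ t : ℝ, x = a A₀ + t • wrDir k l z}), ?_, ?_, ?_⟩
  · refine le_trans ?_ hcard
    have := Finset.card_image_le (s := (Finset.univ : Finset (Fin 3 × Fin k × Fin l)))
      (f := fun z => {x : EuclideanSpace ℝ (Fin 3) | ∃ t : ℝ, x = a A₀ + t • wrDir k l z})
    simp only [Finset.card_univ, Fintype.card_prod, Fintype.card_fin] at this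
    rw [mul_assoc]
    exact_mod_cast this
  · intro ℓ hℓ
    obtain ⟨z, -, rfl⟩ := Finset.mem_image.1 hℓ
    exact ⟨a A₀, wrDir k l z, wr_dir_ne k l z, rfl⟩
  · intro A hA
    obtain ⟨z, t, hz⟩ := wr_dir k l hk hl (a A - a A₀)
    refine ⟨_, Finset.mem_image_of_mem _ (Finset.mem_univ z), a A₀ + t • wrDir k l z,
      ⟨t, rfl⟩, hin A hA ?_⟩
    obtain ⟨y, hy, hy0⟩ := hpair A hA A₀ hA₀
    have d1 := hout A hA hy
    have d2 := hout A₀ hA₀ hy0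
    rw [Metric.mem_closedBall] at d1 d2
    have d3 : ‖a A - a A₀‖ ≤ 2 * D * r A := by
      rw [← dist_eq_norm]
      have := dist_triangle_left (a A) (a A₀) y
      linarith [hmin A hA, hRD A hA]
    have hr' := hr A hA
    rw [Metric.mem_closedBall, dist_comm, dist_eq_norm, ← sub_sub]
    have hk' : (0 : ℝ) < k := by exact_mod_cast hk
    have hl' : (0 : ℝ) < l := by exact_mod_cast hl
    have hf : 4 * D ^ 2 * (1 / (k : ℝ) ^ 2 + 1 / (l : ℝ) ^ 2) ≤ 1 := by
      rw [div_add_div _ _ (by positivity) (by positivity), ← mul_div_assoc,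
        div_le_one (by positivity)]
      linarith
    refine (pow_le_pow_iff_left₀ (norm_nonneg _) hr'.le two_ne_zero).1 ?_
    calc _ ≤ _ := hz
      _ ≤ (2 * D * r A) ^ 2 * (1 / (k : ℝ) ^ 2 + 1 / (l : ℝ) ^ 2) := by gcongr
      _ = r A ^ 2 * (4 * D ^ 2 * (1 / (k : ℝ) ^ 2 + 1 / (l : ℝ) ^ 2)) := by ring
      _ ≤ r A ^ 2 * 1 := by gcongr
      _ = r A ^ 2 := mul_one _
end
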